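/- arXiv:1609.02240 — 4 statements merged into one kernel-verified Lean document; each statement's English description precedes it below -/
import Mathlib

section
/- Fix λ ∈ ℂ. For every polynomial p ∈ 𝕍 and every integer r > 0, the polynomial f_{λ,b}^{∘r}(p) (the result of substituting p for z in the r-th compositional iterate of f_{λ,b}) again belongs to 𝕍; that is, it has zero constant term in z and, for every n ≥ 1, its coefficient of z^n is a polynomial in b of degree at most n − 1. -/
open Polynomial

/-- The cubic family `f_{λ,b}(z) = λz + bz² + z³`, viewed as a polynomial in `z`
with coefficients in `ℂ[b]`. -/
noncomputable def cubicFam (lam : ℂ) : Polynomial (Polynomial ℂ) :=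
  Polynomial.C (Polynomial.C lam) * Polynomial.X +
    Polynomial.C Polynomial.X * Polynomial.X ^ 2 + Polynomial.X ^ 3

/-- Every monomial `bᵐ zⁿ` occurring in `q` satisfies `m + k ≤ n`. -/
def GapAtLeast (k : ℤ) (q : Polynomial (Polynomial ℂ)) : Prop :=
  ∀ n m : ℕ, (n : ℤ) < m + k → (q.coeff n).coeff m = 0

namespace GapAtLeast

variable {j k : ℤ} {p q : Polynomial (Polynomial ℂ)}

theorem add (hp : GapAtLeast k p) (hq : GapAtLeast k q) : GapAtLeast k (p + q) := by
  intro n m h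
  simp [hp n m h, hq n m h]

theorem mul (hp : GapAtLeast j p) (hq : GapAtLeast k q) : GapAtLeast (j + k) (p * q) := by
  intro n m h
  rw [coeff_mul, finsetSum_coeff]
  refine Finset.sum_eq_zero fun x hx => ?_
  rw [coeff_mul]
  refine Finset.sum_eq_zero fun y hy => ?_
  rw [Finset.HasAntidiagonal.mem_antidiagonal] at hx hy
  by_cases hxy : (x.1 : ℤ) < y.1 + j
  · rw [hp _ _ hxy, zero_mul]
  · rw [hq x.2 y.2 (by lia), mul_zero]

theorem mono (hjk : j ≤ k) (hp : GapAtLeast k p) : GapAtLeast j p :=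
  fun n m h => hp n m (by lia)

theorem C_C (a : ℂ) : GapAtLeast 0 (C (C a)) := by
  intro n m h
  have hm : m ≠ 0 := by lia
  rw [coeff_C]
  split_ifs <;> simp [coeff_C, hm]

theorem C_X : GapAtLeast (-1) (C X) := by
  intro n m h
  have hm : 1 ≠ m := by lia
  rw [coeff_C]
  split_ifs <;> simp [coeff_X, hm]

theorem cubicFam_comp (lam : ℂ) (hp : GapAtLeast 1 p) :
    GapAtLeast 1 ((cubicFam lam).comp p) := by
  have h2 : GapAtLeast 2 (p ^ 2) := by simpa [pow_two] using hp.mul hp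
  have h3 : GapAtLeast 3 (p ^ 3) := by simpa [pow_succ p 2] using h2.mul hp
  have h : (cubicFam lam).comp p = C (C lam) * p + C X * p ^ 2 + p ^ 3 := by
    simp [cubicFam]
  rw [h]
  exact (((C_C lam).mul hp).add (C_X.mul h2)).add (h3.mono (by norm_num))

end GapAtLeast

theorem gapAtLeast_one_iff {q : Polynomial (Polynomial ℂ)} :
    GapAtLeast 1 q ↔
      q.coeff 0 = 0 ∧ ∀ n : ℕ, 1 ≤ n → (q.coeff n).natDegree ≤ n - 1 := by
  constructor
  · intro h
    refine ⟨Polynomial.ext fun m => h 0 m (by lia), fun n hn => ?_⟩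
    rw [natDegree_le_iff_coeff_eq_zero]
    exact fun m hm => h n m (by lia)
  · rintro ⟨h0, h⟩ n m hnm
    rcases Nat.eq_zero_or_pos n with rfl | hn
    · rw [h0, coeff_zero]
    · exact coeff_eq_zero_of_natDegree_lt (by have := h n hn; lia)

/-- if `p ∈ 𝕍` (zero constant term in `z`, and the coefficient of `zⁿ` has
degree at most `n - 1` in `b`), then `f_{λ,b}^{∘r}(p) ∈ 𝕍` for every `r > 0`. -/
theorem cubicFam_iterate_mem_V (lam : ℂ) (p : Polynomial (Polynomial ℂ))
    (hp0 : p.coeff 0 = 0)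
    (hp : ∀ n : ℕ, 1 ≤ n → (p.coeff n).natDegree ≤ n - 1)
    (r : ℕ) (hr : 0 < r) :
    ((fun q => (cubicFam lam).comp q)^[r] p).coeff 0 = 0 ∧
      ∀ n : ℕ, 1 ≤ n →
        (((fun q => (cubicFam lam).comp q)^[r] p).coeff n).natDegree ≤ n - 1 := by
  rw [← gapAtLeast_one_iff]
  clear hr
  induction r with
  | zero => exact gapAtLeast_one_iff.mpr ⟨hp0, hp⟩
  | succ r ih =>
    rw [Function.iterate_succ_apply']
    exact ih.cubicFam_comp lam
end

section
/- Let p and q be coprime integers with q ≥ 1 and set λ = e^{2πip/q} (a primitive q-th root of unity). Regard the q-th compositional iterate f_{λ,b}^{∘q}(z) as a polynomial in z with coefficients in ℂ[b]. Then its constant term is 0, its coefficient of z equals 1, its coefficient of z^j vanishes for every j with 2 ≤ j ≤ q, and its coefficient of z^{q+1} is a polynomial T_{p/q}(b) ∈ ℂ[b] that is not identically zero and has degree at most q. (Equivalently, f_{λ,b}^{∘q}(z) = z + T_{p/q}(b) z^{q+1} + O(z^{q+2}).) -/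
open Polynomial

open Filter Topology

/-- A continuous branch of the `n`-th root of a nonvanishing holomorphic function is holomorphic. -/
theorem DifferentiableOn.of_pow_eq {U : Set ℂ} (hU : IsOpen U) {g r : ℂ → ℂ} {n : ℕ} (hn : n ≠ 0)
    (hg : DifferentiableOn ℂ g U) (hr : ContinuousOn r U) (hpow : ∀ w ∈ U, r w ^ n = g w)
    (hne : ∀ w ∈ U, g w ≠ 0) : DifferentiableOn ℂ r U := by
  intro w hw
  have hU' := hU.mem_nhds hw
  have hgw := hne w hw
  have hrw : r w ≠ 0 := fun h => hgw (by rw [← hpow w hw, h, zero_pow hn])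
  have hrc : Tendsto (fun x => r x / r w) (𝓝 w) (𝓝 1) := by
    have := ((hr.continuousAt hU').div_const (r w)).tendsto
    rwa [div_self hrw] at this
  have harg : ∀ᶠ x in 𝓝 w, |(r x / r w).arg| < Real.pi / n := by
    have h1 := ((Complex.continuousAt_arg Complex.one_mem_slitPlane).tendsto.comp hrc).abs
    rw [Complex.arg_one, abs_zero] at h1
    exact h1.eventually_lt_const (by positivity)
  have heq : r =ᶠ[𝓝 w] fun x => r w * (g x / g w) ^ ((n : ℂ)⁻¹) := by
    filter_upwards [harg, hU'] with x hx hxU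
    rw [← hpow x hxU, ← hpow w hw, ← div_pow,
      Complex.pow_cpow_nat_inv hn (abs_lt.mp hx).1 (abs_lt.mp hx).2.le, mul_div_cancel₀ _ hrw]
  have hd : DifferentiableAt ℂ (fun x => r w * (g x / g w) ^ ((n : ℂ)⁻¹)) w := by
    refine (((hg.differentiableAt hU').div_const _).cpow_const (Or.inl ?_)).const_mul _
    rw [div_self hgw]
    simp
  exact (hd.congr_of_eventuallyEq heq).differentiableWithinAt

/-- A holomorphic function on a convex open set avoiding the critical value of
`z ↦ (z + a) ^ n - e` lifts through this polynomial, and the lift may be chosen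
to extend a given partial lift. -/
theorem exists_lift_unicritical {U V : Set ℂ} (hU : IsOpen U) (hUc : Convex ℝ U)
    (hV : IsPreconnected V) (hVne : V.Nonempty) {n : ℕ} (hn : n ≠ 0) (a e : ℂ) {g h F : ℂ → ℂ}
    (hg : DifferentiableOn ℂ g U) (hgne : ∀ w ∈ U, g w ≠ -e)
    (hF : ContinuousOn F V) (hFm : Set.MapsTo F V U) (hh : ContinuousOn h V)
    (hgh : ∀ w ∈ V, (h w + a) ^ n - e = g (F w)) :
    ∃ k : ℂ → ℂ, DifferentiableOn ℂ k U ∧ (∀ w ∈ U, (k w + a) ^ n - e = g w) ∧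
      ∀ w ∈ V, k (F w) = h w := by
  obtain ⟨w₀, hw₀⟩ := hVne
  have hUs : IsSimplyConnected U := by
    have := hUc.contractibleSpace ⟨_, hFm hw₀⟩
    exact (inferInstance : SimplyConnectedSpace U)
  have hne : ∀ w ∈ U, g w + e ≠ 0 := fun w hw h0 => hgne w hw (eq_neg_of_add_eq_zero_left h0)
  obtain ⟨r, hrc, hr⟩ := Complex.exists_continuousOn_pow_eq hUs hU
    (g := fun w => g w + e) (hg.continuousOn.add continuousOn_const)
    (by rintro ⟨w, hw, h0⟩; exact hne w hw h0) hn
  have hrd := DifferentiableOn.of_pow_eq hU hn (hg.add_const e) hrc (fun w _ => hr w) hne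
  have hr0 : ∀ w ∈ U, r w ≠ 0 := fun w hw h0 => hne w hw (by rw [← hr w, h0, zero_pow hn])
  have hfin : {x : ℂ | x ^ n = 1}.Finite := by
    refine ((nthRootsFinset n (1 : ℂ)).finite_toSet).subset fun x hx => ?_
    simpa [mem_nthRootsFinset (Nat.pos_of_ne_zero hn)] using hx
  obtain ⟨ω, hω, hωeq⟩ := hV.eqOn_const_of_mapsTo (f := fun w => (h w + a) / r (F w))
    hfin.isDiscrete
    ((hh.add continuousOn_const).div (hrc.comp hF hFm) fun w hw => hr0 _ (hFm hw))
    (fun w hw => by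
      have h1 : (h w + a) ^ n = g (F w) + e := by rw [← hgh w hw]; ring
      simp only [Set.mem_ofPred_eq, div_pow, hr, h1]
      exact div_self (hne _ (hFm hw)))
    ⟨1, one_pow n⟩
  refine ⟨fun w => ω * r w - a, (hrd.const_mul ω).sub_const a, fun w _ => ?_, fun w hw => ?_⟩
  · have hω' : ω ^ n = 1 := hω
    simp only [sub_add_cancel, mul_pow, hr, hω']
    ring
  · have := hωeq hw
    simp only [Function.const_apply] at this
    rw [div_eq_iff (hr0 _ (hFm hw))] at this
    simp only [← this]
    ring

/-- Iterated form of `exists_lift_unicritical` for functions with values in a backward invariant set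
that omits the critical value. -/
theorem exists_lift_iterate_unicritical {U V : Set ℂ} (hU : IsOpen U) (hUc : Convex ℝ U)
    (hV : IsPreconnected V) (hVne : V.Nonempty) {n : ℕ} (hn : n ≠ 0) (a e : ℂ) {f : ℂ → ℂ}
    (hf : f = fun z => (z + a) ^ n - e) {A : Set ℂ} (hA : ∀ x, f x ∈ A → x ∈ A) (hcrit : -e ∉ A)
    {g F : ℂ → ℂ} (hg : DifferentiableOn ℂ g U) (hgA : ∀ w ∈ U, g w ∈ A)
    (hF : ContinuousOn F V) (hFm : Set.MapsTo F V U) (i : ℕ) {h : ℂ → ℂ} (hh : ContinuousOn h V)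
    (hgh : ∀ w ∈ V, f^[i] (h w) = g (F w)) :
    ∃ k : ℂ → ℂ, DifferentiableOn ℂ k U ∧ (∀ w ∈ U, k w ∈ A) ∧ ∀ w ∈ V, k (F w) = h w := by
  induction i generalizing h with
  | zero => exact ⟨g, hg, hgA, fun w hw => (hgh w hw).symm⟩
  | succ i ih =>
    have hfc : Continuous f := by rw [hf]; fun_prop
    obtain ⟨k, hk, hkA, hkF⟩ := ih (h := f ∘ h) (hfc.comp_continuousOn hh) hgh
    obtain ⟨k', hk', hkk', hkF'⟩ := exists_lift_unicritical hU hUc hV hVne hn a e hk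
      (fun w hw h0 => hcrit (h0 ▸ hkA w hw)) hF hFm hh
      (fun w hw => by rw [hkF w hw, hf]; rfl)
    refine ⟨k', hk', fun w hw => hA _ ?_, hkF'⟩
    have := hkk' w hw
    rw [hf]
    simpa only [this] using hkA w hw

/-- In the coordinate `-1 / (m c z ^ m)`, a map `z ↦ z (1 + z ^ m G(z))` with `G(0) = c ≠ 0`
is close to the translation by `1`. -/
theorem tendsto_parabolic_sub_translation {m : ℕ} (hm : m ≠ 0) {c : ℂ} (hc : c ≠ 0) {G : ℂ → ℂ}
    (hG : ContinuousAt G 0) (hG0 : G 0 = c) :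
    Tendsto (fun z => -1 / (m * c * (z * (1 + z ^ m * G z)) ^ m) - -1 / (m * c * z ^ m) - 1)
      (𝓝[≠] 0) (𝓝 0) := by
  have hm' : (m : ℂ) ≠ 0 := Nat.cast_ne_zero.mpr hm
  have hs : Tendsto (fun z => z ^ m * G z) (𝓝 0) (𝓝 0) := by
    have h : ContinuousAt (fun z => z ^ m * G z) 0 := (continuousAt_id.pow m).mul hG
    simpa [ContinuousAt, zero_pow hm] using h
  have hGne : ∀ᶠ z in 𝓝[≠] (0 : ℂ), G z ≠ 0 :=
    (hG.eventually_ne (by rwa [hG0])).filter_mono nhdsWithin_le_nhds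
  have hs' : Tendsto (fun z => z ^ m * G z) (𝓝[≠] 0) (𝓝[≠] 0) := by
    refine tendsto_nhdsWithin_iff.mpr ⟨hs.mono_left nhdsWithin_le_nhds, ?_⟩
    filter_upwards [hGne, self_mem_nhdsWithin] with z hz hz0
    exact mul_ne_zero (pow_ne_zero _ hz0) hz
  have hder : HasDerivAt (fun s : ℂ => ((1 + s) ^ m)⁻¹) (-(m : ℂ)) 0 := by
    have h1 : HasDerivAt (fun s : ℂ => (1 + s) ^ m) (m : ℂ) 0 := by
      simpa using ((hasDerivAt_id (0 : ℂ)).const_add 1).fun_pow m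
    simpa using h1.fun_inv (by simp)
  have hslope := (hasDerivAt_iff_tendsto_slope.mp hder).comp hs'
  have hGt : Tendsto (fun z => -(G z) / (m * c)) (𝓝[≠] 0) (𝓝 (-c / (m * c))) := by
    have := hG.tendsto.mono_left (nhdsWithin_le_nhds (s := {0}ᶜ))
    rw [hG0] at this
    exact this.neg.div_const _
  have hlim := (hslope.mul hGt).sub_const 1
  have hval : -(m : ℂ) * (-c / (m * c)) - 1 = 0 := by field_simp; ring
  rw [hval] at hlim
  refine hlim.congr' ?_
  filter_upwards [hGne, self_mem_nhdsWithin] with z hz hz0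
  have hz0' : z ≠ 0 := hz0
  have hsz : z ^ m * G z ≠ 0 := mul_ne_zero (pow_ne_zero _ hz0) hz
  simp only [Function.comp_apply, slope_def_field, add_zero, one_pow, inv_one, sub_zero, mul_pow]
  by_cases hu : (1 + z ^ m * G z) ^ m = 0
  · rw [hu]; field_simp; simp
  · field_simp
    ring

theorem Complex.arg_cpow_natCast_inv {x : ℂ} (hx : x ≠ 0) {m : ℕ} (hm : m ≠ 0) :
    (x ^ ((m : ℂ)⁻¹)).arg = x.arg / m := by
  have hm1 : (1 : ℝ) ≤ m := by exact_mod_cast Nat.one_le_iff_ne_zero.mpr hm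
  have hi : (Complex.log x * (m : ℂ)⁻¹).im = x.arg / m := by
    rw [show (m : ℂ)⁻¹ = ((m⁻¹ : ℝ) : ℂ) by push_cast; rfl, Complex.im_mul_ofReal,
      Complex.log_im, div_eq_mul_inv]
  have hb : |x.arg / m| ≤ |x.arg| := by
    rw [abs_div, Nat.abs_cast]; exact div_le_self (abs_nonneg _) hm1
  rw [Complex.cpow_def_of_ne_zero hx, ← Complex.log_im, Complex.log_exp, hi]
  · rw [hi]
    rcases lt_or_ge x.arg 0 with h | h
    · have h2 : x.arg ≤ x.arg / m := by
        rw [le_div_iff₀ (by positivity)]; nlinarith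
      linarith [Complex.neg_pi_lt_arg x]
    · have : 0 ≤ x.arg / m := by positivity
      linarith [Real.pi_pos]
  · rw [hi]
    exact (le_abs_self _).trans (hb.trans (Complex.abs_arg_le_pi x))

/-- An attracting petal of `P(z) = z (1 + z ^ m G(z))` in the direction `v`: a parametrization `Z`
by a right half-plane conjugating `P` to a map `F` close to the translation by `1`, all of whose
orbits converge to `0` tangentially to `v`. -/
theorem exists_attracting_petal {m : ℕ} (hm : m ≠ 0) {c v : ℂ} (hc : c ≠ 0)
    (hv : c * v ^ m = -(‖c‖ : ℂ)) {P G : ℂ → ℂ} (hPc : Continuous P) (hG : Continuous G)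
    (hG0 : G 0 = c) (hP : ∀ z, P z = z * (1 + z ^ m * G z)) :
    ∃ (R : ℝ) (Z F : ℂ → ℂ), DifferentiableOn ℂ Z {w | R < w.re} ∧
      ContinuousOn F {w | R < w.re} ∧ ∀ w : ℂ, R < w.re →
        ‖F w - w - 1‖ ≤ 1 / 4 ∧ P (Z w) = Z (F w) ∧ Z (F w) ≠ Z w ∧
        Tendsto (fun n => Z (F^[n] w)) atTop (𝓝 0) ∧
        Tendsto (fun n => Z (F^[n] w) / ‖Z (F^[n] w)‖) atTop (𝓝 v) := by
  have hm' : (m : ℂ) ≠ 0 := Nat.cast_ne_zero.mpr hm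
  have hmpos : (0 : ℝ) < m := Nat.cast_pos.mpr (Nat.pos_of_ne_zero hm)
  have hcn : 0 < ‖c‖ := norm_pos_iff.mpr hc
  have hcC : (‖c‖ : ℂ) ≠ 0 := by exact_mod_cast hcn.ne'
  have hv1 : ‖v‖ = 1 := by
    have := congrArg norm hv
    rw [norm_mul, norm_neg, norm_pow, Complex.norm_real, norm_norm] at this
    exact (pow_eq_one_iff_of_nonneg (norm_nonneg v) hm).mp (mul_left_cancel₀ hcn.ne' (by linarith))
  have hv0 : v ≠ 0 := norm_ne_zero_iff.mp (by rw [hv1]; exact one_ne_zero)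
  set K : ℝ := m * ‖c‖ with hK
  have hKpos : 0 < K := by positivity
  have hKC : (K : ℂ) ≠ 0 := by exact_mod_cast hKpos.ne'
  set Z : ℂ → ℂ := fun w => v * (1 / (K * w)) ^ ((m : ℂ)⁻¹) with hZ
  set W : ℂ → ℂ := fun z => -1 / (m * c * z ^ m) with hW
  have hWv : ∀ t : ℂ, 1 / (K * W (v * t)) = t ^ m := by
    intro t
    have h1 : (m : ℂ) * c * (v * t) ^ m = -(K : ℂ) * t ^ m := by
      rw [mul_pow, hK]; push_cast
      linear_combination (m : ℂ) * t ^ m * hv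
    simp only [hW, h1]
    by_cases ht : t ^ m = 0
    · simp [ht]
    · field_simp
  have hWZ : ∀ w : ℂ, w ≠ 0 → W (Z w) = w := by
    intro w hw
    have h := hWv ((1 / (K * w)) ^ ((m : ℂ)⁻¹))
    rw [Complex.cpow_nat_inv_pow _ hm, one_div, one_div, inv_inj] at h
    simpa only [hZ, one_div] using mul_left_cancel₀ hKC h
  have hZnorm : ∀ w, ‖Z w‖ ^ m = 1 / (K * ‖w‖) := by
    intro w
    rw [hZ, ← norm_pow, mul_pow, Complex.cpow_nat_inv_pow _ hm, norm_mul, norm_pow, hv1, one_pow,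
      one_mul, norm_div, norm_mul, norm_one, Complex.norm_real, Real.norm_of_nonneg hKpos.le]
  have hZ0 : ∀ w, w ≠ 0 → Z w ≠ 0 := by
    intro w hw h0
    have := hZnorm w
    rw [h0, norm_zero, zero_pow hm] at this
    have : 0 < 1 / (K * ‖w‖) := by have := norm_pos_iff.mpr hw; positivity
    linarith
  have hZsmall : ∀ δ > 0, ∀ w, 1 / (K * δ ^ m) < ‖w‖ → ‖Z w‖ < δ := by
    intro δ hδ w hw
    have hw0 : 0 < ‖w‖ := lt_trans (by positivity) hw
    refine lt_of_pow_lt_pow_left₀ m hδ.le ?_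
    rw [hZnorm, div_lt_iff₀ (by positivity)]
    rw [div_lt_iff₀ (by positivity)] at hw
    linarith
  set D : ℂ → ℂ := fun z => W (P z) - W z - 1 with hD
  have hDt : Tendsto D (𝓝[≠] 0) (𝓝 0) := by
    have := tendsto_parabolic_sub_translation hm hc hG.continuousAt hG0
    simpa only [hD, hW, hP] using this
  have hut : Tendsto (fun z => 1 + z ^ m * G z) (𝓝[≠] 0) (𝓝 1) := by
    have h : ContinuousAt (fun z => 1 + z ^ m * G z) 0 := by fun_prop
    have := h.tendsto.mono_left (nhdsWithin_le_nhds (s := {0}ᶜ))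
    simpa [zero_pow hm] using this
  have hloc : ∀ᶠ z in 𝓝[≠] (0 : ℂ), ‖D z‖ ≤ 1 / 4 ∧ 1 + z ^ m * G z ≠ 0 ∧
      |(1 + z ^ m * G z).arg| < Real.pi / (2 * m) := by
    have h1 : ∀ᶠ z in 𝓝[≠] (0 : ℂ), ‖D z‖ < 1 / 4 :=
      hDt.norm.eventually_lt_const (by norm_num)
    have h2 := ((Complex.continuousAt_arg Complex.one_mem_slitPlane).tendsto.comp hut).abs
    rw [Complex.arg_one, abs_zero] at h2
    filter_upwards [h1, hut.eventually_ne one_ne_zero, h2.eventually_lt_const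
      (show 0 < Real.pi / (2 * m) by positivity)] with z h1 h2 h3
    exact ⟨h1.le, h2, h3⟩
  obtain ⟨δ, hδ, hball⟩ := Metric.mem_nhdsWithin_iff.mp hloc
  set R : ℝ := 1 / (K * δ ^ m) with hR
  have hRpos : 0 < R := by positivity
  have hne : ∀ w : ℂ, R < w.re → w ≠ 0 := by
    rintro w hw rfl
    simp at hw; linarith
  have hinv : ∀ w : ℂ, R < w.re → 0 < (1 / (K * w)).re := by
    intro w hw
    rw [one_div, Complex.inv_re, Complex.re_ofReal_mul]
    have : 0 < w.re := hRpos.trans hw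
    have := Complex.normSq_pos.mpr (mul_ne_zero hKC (hne w hw))
    positivity
  have hgood : ∀ w : ℂ, R < w.re → ‖D (Z w)‖ ≤ 1 / 4 ∧ 1 + Z w ^ m * G (Z w) ≠ 0 ∧
      |(1 + Z w ^ m * G (Z w)).arg| < Real.pi / (2 * m) := by
    intro w hw
    refine hball ⟨?_, hZ0 w (hne w hw)⟩
    rw [mem_ball_zero_iff]
    exact hZsmall δ hδ w (hw.trans_le (Complex.re_le_norm w))
  set F : ℂ → ℂ := fun w => W (P (Z w)) with hF
  have hFD : ∀ w : ℂ, R < w.re → F w = w + 1 + D (Z w) := by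
    intro w hw
    simp only [hF, hD, hWZ w (hne w hw)]
    ring
  have hPZ : ∀ w : ℂ, R < w.re → P (Z w) = Z (F w) := by
    intro w hw
    obtain ⟨-, hu0, hu⟩ := hgood w hw
    have hw0 := hne w hw
    set x : ℂ := 1 / (K * w) with hx
    have hx0 : x ≠ 0 := one_div_ne_zero (mul_ne_zero hKC hw0)
    have hxre : 0 < x.re := hinv w hw
    set t := x ^ ((m : ℂ)⁻¹) with ht
    have ht0 : t ≠ 0 := by
      rw [ht, Complex.cpow_ne_zero_iff]; exact Or.inl hx0
    have htarg : |t.arg| < Real.pi / (2 * m) := by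
      rw [ht, Complex.arg_cpow_natCast_inv hx0 hm, abs_div, Nat.abs_cast, ← div_div]
      have := Complex.abs_arg_lt_pi_div_two_iff.mpr (Or.inl hxre)
      gcongr
    set u := 1 + Z w ^ m * G (Z w) with hu'
    have hsum : |t.arg + u.arg| < Real.pi / m := by
      refine (abs_add_le _ _).trans_lt ((add_lt_add htarg hu).trans_eq ?_)
      field_simp; norm_num
    have hpim : Real.pi / m ≤ Real.pi :=
      div_le_self Real.pi_pos.le (by exact_mod_cast Nat.one_le_iff_ne_zero.mpr hm)
    have harg : (t * u).arg = t.arg + u.arg :=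
      Complex.arg_mul ht0 hu0 ⟨by linarith [(abs_lt.mp hsum).1], by linarith [(abs_lt.mp hsum).2]⟩
    have hPt : P (Z w) = v * (t * u) := by rw [hP, ← hu']; simp only [hZ]; ring
    have hZF : Z (F w) = v * (1 / (K * F w)) ^ ((m : ℂ)⁻¹) := rfl
    rw [hZF]
    simp only [hF]
    rw [hPt, hWv, Complex.pow_cpow_nat_inv hm (by rw [harg]; exact (abs_lt.mp hsum).1)
      (by rw [harg]; exact (abs_lt.mp hsum).2.le)]
  have hFn : ∀ w : ℂ, R < w.re → ‖F w - w - 1‖ ≤ 1 / 4 := by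
    intro w hw
    rw [hFD w hw]
    convert (hgood w hw).1 using 2
    ring
  have hFre : ∀ w : ℂ, R < w.re → w.re + 3 / 4 ≤ (F w).re := by
    intro w hw
    have := (Complex.abs_re_le_norm _).trans (hFn w hw)
    simp only [Complex.sub_re, Complex.one_re] at this
    linarith [(abs_le.mp this).1]
  have hZd : DifferentiableOn ℂ Z {w | R < w.re} := by
    intro w hw
    have hw0 := hne w hw
    have hKw : (K : ℂ) * w ≠ 0 := mul_ne_zero hKC hw0
    have : DifferentiableAt ℂ (fun w : ℂ => 1 / (K * w)) w := by
      fun_prop (disch := exact hKw)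
    exact ((this.cpow_const (Or.inl (hinv w hw))).const_mul v).differentiableWithinAt
  refine ⟨R, Z, F, hZd, ?_, fun w hw => ?_⟩
  · refine ContinuousOn.div continuousOn_const ?_ fun w hw => ?_
    · exact continuousOn_const.mul ((hPc.comp_continuousOn hZd.continuousOn).pow m)
    · rw [hP]
      exact mul_ne_zero (mul_ne_zero hm' hc)
        (pow_ne_zero _ (mul_ne_zero (hZ0 w (hne w hw)) (hgood w hw).2.1))
  have hit : ∀ n : ℕ, w.re + 3 / 4 * n ≤ (F^[n] w).re := by
    intro n
    induction n with
    | zero => simp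
    | succ n ih =>
      rw [Function.iterate_succ_apply']
      have : R < (F^[n] w).re := hw.trans_le (le_trans (by simp) ih)
      have := hFre _ this
      push_cast
      linarith
  have hitR : ∀ n : ℕ, R < (F^[n] w).re := fun n =>
    hw.trans_le (le_trans (by simp) (hit n))
  have hZt : Tendsto (fun n => Z (F^[n] w)) atTop (𝓝 0) := by
    rw [Metric.tendsto_atTop]
    intro ε hε
    obtain ⟨N, hN⟩ := exists_nat_gt (4 / 3 * (1 / (K * ε ^ m)))
    refine ⟨N, fun n hn => ?_⟩
    rw [dist_zero_right]
    refine hZsmall ε hε _ ?_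
    have h1 := (hit n).trans (Complex.re_le_norm _)
    have h2 : (N : ℝ) ≤ n := Nat.cast_le.mpr hn
    have : 0 < w.re := hRpos.trans hw
    linarith
  refine ⟨hFn w hw, hPZ w hw, fun h => ?_, hZt, ?_⟩
  · have hFR : R < (F w).re := hitR 1
    have := congrArg W h
    rw [hWZ _ (hne _ hFR), hWZ _ (hne w hw)] at this
    have h2 := hFre w hw
    rw [this] at h2
    linarith
  have hZne : ∀ n, Z (F^[n] w) ≠ 0 := fun n => hZ0 _ (hne _ (hitR n))
  have hstep : Tendsto (fun n => F^[n + 1] w - F^[n] w) atTop (𝓝 1) := by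
    have h1 := hDt.comp (tendsto_nhdsWithin_iff.mpr ⟨hZt, Eventually.of_forall hZne⟩)
    have h2 := h1.const_add 1
    rw [add_zero] at h2
    refine h2.congr fun n => ?_
    rw [Function.iterate_succ_apply', hFD _ (hitR n), Function.comp_apply]
    ring
  have hquot : Tendsto (fun n : ℕ => ((n : ℝ)⁻¹ : ℝ) • F^[n] w) atTop (𝓝 1) := by
    have h1 := hstep.cesaro_smul
    have h2 : Tendsto (fun n : ℕ => ((n : ℝ)⁻¹ : ℝ) • w) atTop (𝓝 0) := by
      simpa using (tendsto_inv_atTop_nhds_zero_nat (𝕜 := ℝ)).smul_const w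
    have h3 := h1.add h2
    rw [add_zero] at h3
    refine h3.congr fun n => ?_
    rw [Finset.sum_range_sub (fun n => F^[n] w), ← smul_add]
    simp
  have hargw : Tendsto (fun n : ℕ => (F^[n] w).arg) atTop (𝓝 0) := by
    have h1 := (Complex.continuousAt_arg Complex.one_mem_slitPlane).tendsto.comp hquot
    rw [Complex.arg_one] at h1
    refine h1.congr' ?_
    filter_upwards [eventually_gt_atTop 0] with n hn
    rw [Function.comp_apply, Complex.real_smul, Complex.arg_real_mul]
    positivity
  have hdir : ∀ n : ℕ, Z (F^[n] w) / ‖Z (F^[n] w)‖ =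
      v * Complex.exp ((-(F^[n] w).arg / m : ℝ) * Complex.I) := by
    intro n
    set y := F^[n] w
    have hy : R < y.re := hitR n
    have hy0 := hne y hy
    have hx0 : 1 / (K * y) ≠ 0 := one_div_ne_zero (mul_ne_zero hKC hy0)
    set t := (1 / (K * y)) ^ ((m : ℂ)⁻¹) with ht
    have ht0 : t ≠ 0 := by
      rw [ht, Complex.cpow_ne_zero_iff]; exact Or.inl hx0
    have harg : t.arg = -y.arg / m := by
      rw [ht, Complex.arg_cpow_natCast_inv hx0 hm, one_div, Complex.arg_inv,
        Complex.arg_real_mul _ hKpos, if_neg]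
      have := Complex.abs_arg_lt_pi_div_two_iff.mpr (Or.inl (hRpos.trans hy))
      have := (abs_lt.mp this).2
      intro h
      linarith [Real.pi_pos]
    have hZy : Z y = v * t := rfl
    have htn : (‖t‖ : ℂ) ≠ 0 := by exact_mod_cast norm_ne_zero_iff.mpr ht0
    rw [hZy, norm_mul, hv1, one_mul, ← harg, div_eq_iff htn, mul_assoc, mul_comm (Complex.exp _),
      Complex.norm_mul_exp_arg_mul_I]
  simp only [hdir]
  have hlim : Tendsto (fun n : ℕ => -(F^[n] w).arg / m) atTop (𝓝 0) := by
    simpa using hargw.neg.div_const (m : ℝ)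
  have hcont : Continuous fun s : ℝ => v * Complex.exp (s * Complex.I) := by fun_prop
  have := (hcont.tendsto 0).comp hlim
  rwa [Complex.ofReal_zero, zero_mul, Complex.exp_zero, mul_one] at this

/-- The orbit of `x` under `P` tends to `0`, along directions whose `q`-th powers tend to `u`. -/
def asymptoticBasin (P : ℂ → ℂ) (q : ℕ) (u : ℂ) : Set ℂ :=
  {x | Tendsto (fun k => P^[k] x) atTop (𝓝 0) ∧
    Tendsto (fun k => (P^[k] x / ‖P^[k] x‖) ^ q) atTop (𝓝 u)}

theorem mem_asymptoticBasin_of_map_mem {f e : ℂ → ℂ} (he : Continuous e)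
    (hf : ∀ z, f z = z * e z) {q : ℕ} (hq : 1 ≤ q) (heq : e 0 ^ q = 1) {u x : ℂ}
    (hx : f x ∈ asymptoticBasin f^[q] q u) : x ∈ asymptoticBasin f^[q] q u := by
  have hfc : Continuous f := by rw [funext hf]; fun_prop
  have hf0 : f 0 = 0 := by rw [hf, zero_mul]
  have hcomm : ∀ k, (f^[q])^[k] (f x) = f ((f^[q])^[k] x) := fun k => by
    rw [← Function.iterate_mul, ← Function.iterate_succ_apply, Function.iterate_succ_apply']
  obtain ⟨h1, h2⟩ := hx
  simp only [hcomm] at h1 h2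
  have hy : Tendsto (fun k => (f^[q])^[k] x) atTop (𝓝 0) := by
    rw [← tendsto_add_atTop_iff_nat 1]
    have h3 := ((hfc.iterate (q - 1)).tendsto 0).comp h1
    rw [Function.iterate_fixed hf0] at h3
    refine h3.congr fun k => ?_
    rw [Function.iterate_succ_apply', Function.comp_apply, ← Function.iterate_succ_apply,
      Nat.succ_eq_add_one, Nat.sub_add_cancel hq]
  refine ⟨hy, ?_⟩
  have hen : ‖e 0‖ = 1 := Complex.norm_eq_one_of_pow_eq_one heq (by omega)
  have he0 : e 0 ≠ 0 := norm_ne_zero_iff.mp (by rw [hen]; exact one_ne_zero)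
  have hey : Tendsto (fun k => e ((f^[q])^[k] x)) atTop (𝓝 (e 0)) := (he.tendsto 0).comp hy
  have hsgn : Tendsto (fun k => (e ((f^[q])^[k] x) / ‖e ((f^[q])^[k] x)‖) ^ q) atTop (𝓝 1) := by
    have h3 : ContinuousAt (fun z : ℂ => (z / ‖z‖) ^ q) (e 0) := by
      have : (‖e 0‖ : ℂ) ≠ 0 := by rw [hen]; simp
      fun_prop (disch := exact this)
    have h4 := h3.tendsto.comp hey
    rwa [hen, Complex.ofReal_one, div_one, heq] at h4
  have h5 := h2.div hsgn one_ne_zero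
  rw [div_one] at h5
  refine h5.congr' ?_
  filter_upwards [hey.eventually_ne he0] with k hk
  have hk' : (‖e ((f^[q])^[k] x)‖ : ℂ) ≠ 0 := by exact_mod_cast norm_ne_zero_iff.mpr hk
  simp only [Pi.div_apply]
  rw [hf ((f^[q])^[k] x), norm_mul, Complex.ofReal_mul, mul_div_mul_comm, mul_pow,
    mul_div_assoc, div_self (pow_ne_zero _ (div_ne_zero hk hk')), mul_one]

/-- The critical value `-a ^ 3` of the unicritical cubic `(z + a) ^ 3 - a ^ 3` is attracted along
every attracting direction of a parabolic fixed point at `0`. -/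
theorem neg_cube_mem_asymptoticBasin {a lam : ℂ} (ha : 3 * a ^ 2 = lam) {q : ℕ} (hq : 1 ≤ q)
    (hlam : lam ^ q = 1) {f : ℂ → ℂ} (hf : f = fun z => (z + a) ^ 3 - a ^ 3) {m : ℕ} (hm : m ≠ 0)
    {G : ℂ → ℂ} (hG : Continuous G) {c v : ℂ} (hc : c ≠ 0) (hG0 : G 0 = c)
    (hP : ∀ z, f^[q] z = z * (1 + z ^ m * G z)) (hv : c * v ^ m = -(‖c‖ : ℂ)) :
    -a ^ 3 ∈ asymptoticBasin f^[q] q (v ^ q) := by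
  by_contra hcrit
  have hfc : Continuous f := by rw [hf]; fun_prop
  have hfe : ∀ z, f z = z * (lam + 3 * a * z + z ^ 2) := fun z => by rw [hf, ← ha]; ring
  obtain ⟨R, Z, F, hZd, hFc, hpet⟩ :=
    exists_attracting_petal hm hc hv (hfc.iterate q) hG hG0 hP
  set U : Set ℂ := {w | R < w.re} with hU
  have hUo : IsOpen U := isOpen_lt continuous_const Complex.continuous_re
  have hUc : Convex ℝ U := convex_halfSpace_re_gt R
  have hUne : U.Nonempty := ⟨(R + 1 : ℝ), by simp [hU]⟩
  have hFre : ∀ w ∈ U, w.re + 3 / 4 ≤ (F w).re := by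
    intro w hw
    have := (Complex.abs_re_le_norm _).trans (hpet w hw).1
    simp only [Complex.sub_re, Complex.one_re] at this
    linarith [(abs_le.mp this).1]
  have hFm : Set.MapsTo F U U := fun w hw => by
    have h1 : R < w.re := hw
    have h2 := hFre w hw
    change R < (F w).re
    linarith
  have hPn : ∀ n, ∀ w ∈ U, (f^[q])^[n] (Z w) = Z (F^[n] w) := by
    intro n w hw
    induction n with
    | zero => rfl
    | succ n ih =>
      rw [Function.iterate_succ_apply', Function.iterate_succ_apply', ih,
        (hpet _ (hFm.iterate n hw)).2.1]
  have hZA : ∀ w ∈ U, Z w ∈ asymptoticBasin f^[q] q (v ^ q) := by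
    intro w hw
    obtain ⟨-, -, -, h1, h2⟩ := hpet w hw
    simp only [asymptoticBasin, Set.mem_ofPred_eq, hPn _ w hw]
    exact ⟨h1, h2.pow q⟩
  set M : ℝ := 3 * ‖a‖ + ‖lam‖ + 1 with hM
  have hMpos : 0 < M := by positivity
  have hbound : ∀ x ∈ asymptoticBasin f^[q] q (v ^ q), ‖x‖ ≤ M := by
    rintro x ⟨hx, -⟩
    by_contra! hlt
    have hgrow : ∀ z : ℂ, M < ‖z‖ → ‖z‖ ≤ ‖f z‖ := by
      intro z hz
      rw [hfe, norm_mul]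
      refine le_mul_of_one_le_right (norm_nonneg z) ?_
      have h1 : ‖z ^ 2‖ ≤ ‖lam + 3 * a * z + z ^ 2‖ + ‖lam‖ + 3 * ‖a‖ * ‖z‖ := by
        have e1 : z ^ 2 = (lam + 3 * a * z + z ^ 2) - lam - 3 * a * z := by ring
        have e2 : ‖3 * a * z‖ = 3 * ‖a‖ * ‖z‖ := by simp
        rw [← e2]
        nth_rewrite 1 [e1]
        exact (norm_sub_le _ _).trans (add_le_add_left (norm_sub_le _ _) _)
      rw [norm_pow] at h1
      nlinarith [norm_nonneg a, norm_nonneg lam]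
    have hgrow' : ∀ n, M < ‖f^[n] x‖ := by
      intro n
      induction n with
      | zero => exact hlt
      | succ n ih => rw [Function.iterate_succ_apply']; exact ih.trans_le (hgrow _ ih)
    have h2 := hx.norm.eventually_lt_const (show ‖(0 : ℂ)‖ < M by simpa using hMpos)
    obtain ⟨n, hn⟩ := h2.exists
    rw [← Function.iterate_mul] at hn
    exact lt_asymm hn (hgrow' _)
  obtain ⟨w, hw⟩ := hUne
  have hre : ∀ n : ℕ, R + 3 / 4 * n ≤ (F^[n] w).re := by
    intro n
    induction n with
    | zero => simpa using (show R < w.re from hw).le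
    | succ n ih =>
      rw [Function.iterate_succ_apply']
      have := hFre _ (hFm.iterate n hw)
      push_cast
      linarith
  have hdist : ∀ n : ℕ, 2 ≤ n → dist (Z (F w)) (Z w) ≤ 2 * M / (3 / 4 * n) * (5 / 4) := by
    intro n hn
    have hn' : (2 : ℝ) ≤ n := by exact_mod_cast hn
    have hnpos : (0 : ℝ) < 3 / 4 * n := by positivity
    obtain ⟨k, hkd, hkA, hkF⟩ := exists_lift_iterate_unicritical hUo hUc hUc.isPreconnected ⟨w, hw⟩
      three_ne_zero a (a ^ 3) hf
      (A := asymptoticBasin f^[q] q (v ^ q))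
      (fun x => mem_asymptoticBasin_of_map_mem (e := fun z => lam + 3 * a * z + z ^ 2)
        (by fun_prop) hfe hq (by simpa using hlam)) hcrit hZd hZA
      (hFc.iterate hFm n) (hFm.iterate n) (q * n) hZd.continuousOn
      (fun w hw => by rw [Function.iterate_mul]; exact hPn n w hw)
    set y := F^[n] w with hy
    have hyU : y ∈ U := hFm.iterate n hw
    have hFy : F y = F^[n] (F w) := by
      rw [hy, ← Function.iterate_succ_apply' F, Function.iterate_succ_apply]
    have hsub : Metric.ball y (3 / 4 * n) ⊆ U := by
      intro z hz
      rw [mem_ball_iff_norm] at hz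
      have h1 := (Complex.abs_re_le_norm _).trans_lt hz
      rw [Complex.sub_re] at h1
      have h2 := hre n
      change R < z.re
      linarith [(abs_lt.mp h1).1]
    have hd : dist (F y) y ≤ 5 / 4 := by
      have h1 := (hpet y hyU).1
      have h2 := norm_add_le (F y - y - 1) 1
      rw [sub_add_cancel, norm_one] at h2
      rw [dist_eq_norm]
      linarith
    have hmaps : Set.MapsTo k (Metric.ball y (3 / 4 * n)) (Metric.closedBall (k y) (2 * M)) := by
      intro z hz
      rw [mem_closedBall_iff_norm]
      have h1 := hbound _ (hkA z (hsub hz))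
      have h2 := hbound _ (hkA y hyU)
      linarith [norm_sub_le (k z) (k y)]
    have h3 := Complex.dist_le_div_mul_dist_of_mapsTo_ball (hkd.mono hsub) hmaps
      (z := F y) (by rw [Metric.mem_ball]; linarith)
    rw [hFy, hkF _ (hFm hw), hy, hkF w hw, ← hy, ← hFy] at h3
    exact h3.trans (mul_le_mul_of_nonneg_left hd (by positivity))
  have hlim : Tendsto (fun n : ℕ => 2 * M / (3 / 4 * n) * (5 / 4)) atTop (𝓝 0) := by
    have h1 : Tendsto (fun n : ℕ => (3 / 4 : ℝ) * n) atTop atTop :=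
      tendsto_natCast_atTop_atTop.const_mul_atTop (by norm_num)
    simpa using (h1.const_div_atTop (2 * M)).mul_const (5 / 4)
  have hle : dist (Z (F w)) (Z w) ≤ 0 :=
    ge_of_tendsto hlim (by filter_upwards [eventually_ge_atTop 2] with n hn using hdist n hn)
  exact (hpet w hw).2.2.1 (dist_le_zero.mp hle)

/-- **Fatou's theorem** for the unicritical cubic `(z + a) ^ 3 - a ^ 3` whose fixed point `0` has
multiplier a `q`-th root of unity: it has at most `q` attracting directions. -/
theorem parabolic_order_le {a lam : ℂ} (ha : 3 * a ^ 2 = lam) {q : ℕ} (hq : 1 ≤ q)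
    (hlam : lam ^ q = 1) {f : ℂ → ℂ} (hf : f = fun z => (z + a) ^ 3 - a ^ 3) {m : ℕ} (hm : m ≠ 0)
    {G : ℂ → ℂ} (hG : Continuous G) (hG0 : G 0 ≠ 0)
    (hP : ∀ z, f^[q] z = z * (1 + z ^ m * G z)) : m ≤ q := by
  obtain ⟨v, hv⟩ := IsAlgClosed.exists_pow_nat_eq (-(‖G 0‖ : ℂ) / G 0) (Nat.pos_of_ne_zero hm)
  have hv1 : G 0 * v ^ m = -(‖G 0‖ : ℂ) := by rw [hv]; field_simp
  have hvne : v ≠ 0 := by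
    rintro rfl
    rw [zero_pow hm, mul_zero] at hv1
    exact hG0 (by simpa using hv1.symm)
  have hζ := Complex.isPrimitiveRoot_exp m hm
  set ζ := Complex.exp (2 * Real.pi * Complex.I / m)
  have h1 := neg_cube_mem_asymptoticBasin ha hq hlam hf hm hG hG0 rfl hP hv1
  have h2 := neg_cube_mem_asymptoticBasin ha hq hlam hf hm hG hG0 rfl hP (v := v * ζ)
    (by rw [mul_pow, hζ.pow_eq_one, mul_one, hv1])
  have h3 := tendsto_nhds_unique h1.2 h2.2
  rw [mul_pow] at h3
  have h4 : ζ ^ q = 1 := by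
    have := pow_ne_zero q hvne
    field_simp at h3
    exact h3.symm
  exact Nat.le_of_dvd hq (hζ.dvd_of_pow_eq_one q h4)

theorem Polynomial.exists_eq_X_pow_mul_coeff_zero_ne_zero {S : Type*} [CommRing S] {p : S[X]}
    (hp : p ≠ 0) : ∃ (k : ℕ) (G : S[X]), p = X ^ k * G ∧ G.coeff 0 ≠ 0 := by
  obtain ⟨G, hG, hndvd⟩ := exists_eq_pow_rootMultiplicity_mul_and_not_dvd p hp 0
  rw [map_zero, sub_zero] at hG hndvd
  exact ⟨_, G, hG, fun h => hndvd (X_dvd_iff.mpr h)⟩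

theorem Polynomial.le_of_eq_X_pow_mul {S : Type*} [CommRing S] {p G : S[X]} {k n : ℕ}
    (hp : p = X ^ k * G) (hG : G.coeff 0 ≠ 0) (hn : ∀ j < n, p.coeff j = 0) : n ≤ k := by
  by_contra! h
  have := hn k h
  rw [hp, coeff_X_pow_mul', if_pos le_rfl, Nat.sub_self] at this
  exact hG this

theorem cubicFam_comp (lam : ℂ) (s : ℂ[X][X]) :
    (cubicFam lam).comp s = C (C lam) * s + C X * s ^ 2 + s ^ 3 := by
  simp [cubicFam]

theorem natDegree_cubicFam (lam : ℂ) : (cubicFam lam).natDegree = 3 := by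
  unfold cubicFam
  compute_degree!

/-- `(s.coeff j).natDegree ≤ j - d` for all `j`, and `s.coeff j = 0` for `j < d`. -/
def WeightedDegreeLE (d : ℕ) (s : ℂ[X][X]) : Prop :=
  ∀ j, s.coeff j ≠ 0 → d + (s.coeff j).natDegree ≤ j

theorem WeightedDegreeLE.mono {d d' : ℕ} {s : ℂ[X][X]} (h : WeightedDegreeLE d s) (hd : d' ≤ d) :
    WeightedDegreeLE d' s := fun j hj => (Nat.add_le_add_right hd _).trans (h j hj)

theorem WeightedDegreeLE.add {d : ℕ} {s t : ℂ[X][X]} (hs : WeightedDegreeLE d s)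
    (ht : WeightedDegreeLE d t) : WeightedDegreeLE d (s + t) := by
  intro j hj
  rw [coeff_add] at hj ⊢
  have h := natDegree_add_le (s.coeff j) (t.coeff j)
  by_cases h1 : s.coeff j = 0
  · rw [h1, zero_add] at hj ⊢
    exact ht j hj
  by_cases h2 : t.coeff j = 0
  · rw [h2, add_zero] at hj ⊢
    exact hs j hj
  have := hs j h1
  have := ht j h2
  omega

theorem WeightedDegreeLE.mul {d e : ℕ} {s t : ℂ[X][X]} (hs : WeightedDegreeLE d s)
    (ht : WeightedDegreeLE e t) : WeightedDegreeLE (d + e) (s * t) := by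
  intro j hj
  rw [coeff_mul] at hj ⊢
  have hterm : ∀ x ∈ Finset.HasAntidiagonal.antidiagonal j, s.coeff x.1 * t.coeff x.2 ≠ 0 →
      d + e + (s.coeff x.1 * t.coeff x.2).natDegree ≤ j := by
    intro x hx h
    have h1 := hs x.1 (left_ne_zero_of_mul h)
    have h2 := ht x.2 (right_ne_zero_of_mul h)
    have h3 := Finset.HasAntidiagonal.mem_antidiagonal.mp hx
    have h4 := natDegree_mul_le (p := s.coeff x.1) (q := t.coeff x.2)
    omega
  obtain ⟨x, hx, hx0⟩ := Finset.exists_ne_zero_of_sum_ne_zero hj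
  have hde := hterm x hx hx0
  have hsum : (∑ x ∈ Finset.HasAntidiagonal.antidiagonal j, s.coeff x.1 * t.coeff x.2).natDegree ≤ j - (d + e) := by
    refine natDegree_sum_le_of_forall_le _ _ fun y hy => ?_
    by_cases h : s.coeff y.1 * t.coeff y.2 = 0
    · rw [h, natDegree_zero]
      exact Nat.zero_le _
    · have := hterm y hy h
      omega
  omega

theorem WeightedDegreeLE.C_C_mul {d : ℕ} {s : ℂ[X][X]} (hs : WeightedDegreeLE d s) (a : ℂ) :
    WeightedDegreeLE d (C (C a) * s) := by
  intro j hj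
  rw [coeff_C_mul] at hj ⊢
  have := hs j (right_ne_zero_of_mul hj)
  have := natDegree_C_mul_le a (s.coeff j)
  omega

theorem WeightedDegreeLE.C_X_mul {d : ℕ} {s : ℂ[X][X]} (hs : WeightedDegreeLE (d + 1) s) :
    WeightedDegreeLE d (C X * s) := by
  intro j hj
  rw [coeff_C_mul] at hj ⊢
  have := hs j (right_ne_zero_of_mul hj)
  have h := natDegree_mul_le (p := X) (q := s.coeff j)
  rw [natDegree_X] at h
  omega

theorem weightedDegreeLE_cubicFam_iterate (lam : ℂ) (n : ℕ) :
    WeightedDegreeLE 1 ((cubicFam lam).comp^[n] X) := by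
  induction n with
  | zero =>
    intro j hj
    rw [Function.iterate_zero_apply, coeff_X] at hj ⊢
    split_ifs at hj ⊢ with h
    · simp [← h]
    · exact absurd rfl hj
  | succ n ih =>
    rw [Function.iterate_succ_apply', cubicFam_comp]
    have h2 := ih.mul ih
    have h3 := h2.mul ih
    rw [← pow_two] at h2
    rw [← pow_two, ← pow_succ] at h3
    exact ((ih.C_C_mul lam).add h2.C_X_mul).add (h3.mono (by norm_num))

theorem cubicFam_iterate_coeff_zero (lam : ℂ) (n : ℕ) :
    ((cubicFam lam).comp^[n] X).coeff 0 = 0 := by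
  by_contra h
  have := weightedDegreeLE_cubicFam_iterate lam n 0 h
  omega

theorem cubicFam_iterate_coeff_one (lam : ℂ) (n : ℕ) :
    ((cubicFam lam).comp^[n] X).coeff 1 = C (lam ^ n) := by
  induction n with
  | zero => simp
  | succ n ih =>
    obtain ⟨t, ht⟩ := X_dvd_iff.mpr (cubicFam_iterate_coeff_zero lam n)
    rw [Function.iterate_succ_apply', cubicFam_comp, coeff_add, coeff_add, coeff_C_mul, coeff_C_mul,
      ih, ht, mul_pow, mul_pow, coeff_X_pow_mul', coeff_X_pow_mul', pow_succ lam]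
    simp [mul_comm]

/-- The order of contact of an iterate of `cubicFam lam` with the identity is resonant. -/
theorem pow_eq_one_of_cubicFam_iterate_eq {lam : ℂ} (hlam : lam ≠ 0) {n m : ℕ} {G : ℂ[X][X]}
    (hG : G.coeff 0 ≠ 0) (hP : (cubicFam lam).comp^[n] X = X + X ^ (m + 1) * G) : lam ^ m = 1 := by
  set f := cubicFam lam
  have hcomm : f.comp (X + X ^ (m + 1) * G) = (X + X ^ (m + 1) * G).comp f := by
    have hit : ∀ k (s : ℂ[X][X]), (f.comp^[k] X).comp s = f.comp^[k] s := by
      intro k s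
      induction k with
      | zero => simp
      | succ k ih => rw [Function.iterate_succ_apply', Function.iterate_succ_apply', comp_assoc, ih]
    rw [← hP, hit, ← Function.iterate_succ_apply' (f := f.comp), Function.iterate_succ_apply, comp_X]
  set Q : ℂ[X][X] := X ^ m * G
  have hf : f = X * (C (C lam) + C X * X + X ^ 2) := by
    simp only [f, cubicFam]; ring
  have hl : f.comp (X + X ^ (m + 1) * G) = f + X ^ (m + 1) * (G * (C (C lam) +
      C X * (X * (2 + Q)) + X ^ 2 * ((1 + Q) ^ 2 + (1 + Q) + 1))) := by
    rw [cubicFam_comp]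
    simp only [f, cubicFam, Q]
    ring
  have hr : (X + X ^ (m + 1) * G).comp f = f + X ^ (m + 1) *
      ((C (C lam) + C X * X + X ^ 2) ^ (m + 1) * G.comp f) := by
    rw [add_comp, mul_comp, X_pow_comp, X_comp, ← mul_assoc, ← mul_pow, ← hf]
  rw [hl, hr, add_right_inj] at hcomm
  have hcancel := mul_left_cancel₀ (pow_ne_zero _ X_ne_zero) hcomm
  have h0 := congrArg (eval 0) hcancel
  have hf0 : eval 0 f = 0 := by rw [hf]; simp
  simp only [eval_mul, eval_add, eval_C, eval_X, eval_pow, eval_comp, hf0, zero_mul, mul_zero,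
    add_zero, ne_eq, OfNat.ofNat_ne_zero, not_false_eq_true, zero_pow, ← coeff_zero_eq_eval_zero]
    at h0
  rw [mul_comm] at h0
  have h1 := mul_right_cancel₀ hG h0
  rw [← C_pow, C_inj, pow_succ] at h1
  exact mul_right_cancel₀ hlam (by rw [one_mul, ← h1])

theorem cubicFam_map_evalRingHom (lam a : ℂ) (ha : 3 * a ^ 2 = lam) :
    (cubicFam lam).map (evalRingHom (3 * a)) = (X + C a) ^ 3 - C (a ^ 3) := by
  simp only [cubicFam, ← ha, Polynomial.map_add, Polynomial.map_mul, Polynomial.map_pow, map_C,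
    map_X, coe_evalRingHom, eval_C, eval_X, C_mul, C_pow]
  rw [show C (3 : ℂ) = 3 from rfl]
  ring

/-- for `λ = e^{2πip/q}` with `p, q` coprime and `q ≥ 1`, one has
`f_{λ,b}^{∘q}(z) = z + T_{p/q}(b) z^{q+1} + O(z^{q+2})`, where the coefficient
`T_{p/q}(b)` of `z^{q+1}` is a nonzero polynomial in `b` of degree at most `q`. -/
theorem cubicFam_iterate_q_expansion (p : ℤ) (q : ℕ) (hq : 1 ≤ q)
    (hcop : Int.gcd p (q : ℤ) = 1)
    (lam : ℂ) (hlam : lam = Complex.exp (2 * Real.pi * Complex.I * (p : ℂ) / (q : ℂ))) :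
    (((fun s => (cubicFam lam).comp s)^[q] Polynomial.X).coeff 0 = 0) ∧
      (((fun s => (cubicFam lam).comp s)^[q] Polynomial.X).coeff 1 = 1) ∧
      (∀ j : ℕ, 2 ≤ j → j ≤ q →
        ((fun s => (cubicFam lam).comp s)^[q] Polynomial.X).coeff j = 0) ∧
      (((fun s => (cubicFam lam).comp s)^[q] Polynomial.X).coeff (q + 1) ≠ 0) ∧
      (((fun s => (cubicFam lam).comp s)^[q] Polynomial.X).coeff (q + 1)).natDegree ≤ q := by
  have hprim : IsPrimitiveRoot lam q := by
    have h := (Complex.isPrimitiveRoot_exp q (by omega)).zpow_of_gcd_eq_one p hcop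
    rw [← Complex.exp_int_mul] at h
    rw [hlam]
    rwa [show 2 * Real.pi * Complex.I * (p : ℂ) / (q : ℂ) = p * (2 * Real.pi * Complex.I / q) by ring]
  have hlam0 : lam ≠ 0 := hprim.ne_zero (by omega)
  have h0 := cubicFam_iterate_coeff_zero lam q
  have h1 := cubicFam_iterate_coeff_one lam q
  rw [hprim.pow_eq_one, C_1] at h1
  change (((cubicFam lam).comp^[q] X).coeff 0 = 0) ∧ (((cubicFam lam).comp^[q] X).coeff 1 = 1) ∧
    (∀ j : ℕ, 2 ≤ j → j ≤ q → ((cubicFam lam).comp^[q] X).coeff j = 0) ∧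
    (((cubicFam lam).comp^[q] X).coeff (q + 1) ≠ 0) ∧
    (((cubicFam lam).comp^[q] X).coeff (q + 1)).natDegree ≤ q
  have hvanish : ∀ j : ℕ, 2 ≤ j → j ≤ q → ((cubicFam lam).comp^[q] X).coeff j = 0 := by
    have hne : (cubicFam lam).comp^[q] X - X ≠ 0 := by
      intro h
      have h2 := congrArg natDegree (sub_eq_zero.mp h)
      rw [natDegree_iterate_comp, natDegree_cubicFam, natDegree_X, mul_one] at h2
      have := Nat.one_lt_pow (by omega : q ≠ 0) (by norm_num : 1 < 3)
      omega
    obtain ⟨k, G, hk, hG⟩ := exists_eq_X_pow_mul_coeff_zero_ne_zero hne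
    have hk2 : 2 ≤ k := le_of_eq_X_pow_mul hk hG fun j hj => by
      interval_cases j <;> simp [h0, h1]
    obtain ⟨m, rfl⟩ : ∃ m, k = m + 1 := ⟨k - 1, by omega⟩
    have hm := pow_eq_one_of_cubicFam_iterate_eq hlam0 hG (eq_add_of_sub_eq' hk)
    have hqm : q ≤ m := Nat.le_of_dvd (by omega) (hprim.dvd_of_pow_eq_one m hm)
    intro j hj2 hjq
    rw [eq_add_of_sub_eq' hk, coeff_add, coeff_X, if_neg (by omega), coeff_X_pow_mul',
      if_neg (by omega), add_zero]
  refine ⟨h0, h1, hvanish, fun hT => ?_, ?_⟩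
  · obtain ⟨a, ha⟩ := IsAlgClosed.exists_pow_nat_eq (lam / 3) (n := 2) two_pos
    have ha' : 3 * a ^ 2 = lam := by rw [ha]; ring
    set φ := evalRingHom (3 * a)
    have hφ := cubicFam_map_evalRingHom lam a ha'
    set g : ℂ[X] := (X + C a) ^ 3 - C (a ^ 3) with hg
    have hmap : ∀ n, ((cubicFam lam).comp^[n] X).map φ = g.comp^[n] X := by
      intro n
      induction n with
      | zero => simp
      | succ n ih =>
        rw [Function.iterate_succ_apply', Function.iterate_succ_apply', Polynomial.map_comp, ih, hφ]
    have hgd : g.natDegree = 3 := by rw [hg, natDegree_sub_C, natDegree_pow, natDegree_X_add_C]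
    have hne : g.comp^[q] X - X ≠ 0 := by
      intro h
      have h2 := congrArg natDegree (sub_eq_zero.mp h)
      rw [natDegree_iterate_comp, hgd, natDegree_X, mul_one] at h2
      have := Nat.one_lt_pow (by omega : q ≠ 0) (by norm_num : 1 < 3)
      omega
    obtain ⟨k, G, hk, hG⟩ := exists_eq_X_pow_mul_coeff_zero_ne_zero hne
    have hk2 : q + 2 ≤ k := le_of_eq_X_pow_mul hk hG fun j hj => by
      rw [coeff_sub, ← hmap, coeff_map, coeff_X]
      rcases Nat.lt_or_ge j 2 with h | h
      · interval_cases j <;> simp [h0, h1]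
      · rw [if_neg (by omega), sub_zero]
        rcases Nat.lt_or_ge q j with h' | h'
        · rw [show j = q + 1 by omega, hT, map_zero]
        · rw [hvanish j h h', map_zero]
    obtain ⟨m, rfl⟩ : ∃ m, k = m + 1 := ⟨k - 1, by omega⟩
    have hP : ∀ z, (fun z => (z + a) ^ 3 - a ^ 3)^[q] z = z * (1 + z ^ m * G.eval z) := by
      intro z
      have h2 := congrArg (eval z) (eq_add_of_sub_eq' hk)
      rw [iterate_comp_eval] at h2
      simp only [hg, eval_sub, eval_pow, eval_add, eval_X, eval_C, eval_mul] at h2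
      rw [h2]
      ring
    have := parabolic_order_le ha' hq hprim.pow_eq_one rfl (m := m) (by omega) G.continuous
      (by rwa [← coeff_zero_eq_eval_zero]) hP
    omega
  · by_cases hT : ((cubicFam lam).comp^[q] X).coeff (q + 1) = 0
    · rw [hT, natDegree_zero]
      exact Nat.zero_le q
    · have := weightedDegreeLE_cubicFam_iterate lam q _ hT
      omega
end

section
/- Let p and q be coprime integers with q ≥ 1, set λ = e^{2πip/q}, and let T_{p/q}(b) ∈ ℂ[b] be the coefficient of z^{q+1} in the q-th compositional iterate f_{λ,b}^{∘q}(z), regarded as a polynomial in b. Then T_{p/q} has degree exactly q, and it has q distinct complex roots (all of its roots are simple). -/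
open Polynomial

section Algebra

variable {R : Type*} [CommRing R]

theorem iterate_comp_X_succ (f : R[X]) (n : ℕ) :
    f.comp^[n + 1] X = (f.comp^[n] X).comp f := by
  induction n with
  | zero => simp
  | succ n ih =>
    rw [Function.iterate_succ_apply', ih, ← comp_assoc, ← ih, Function.iterate_succ_apply']

theorem X_pow_dvd_comp {f u : R[X]} (hf : X ∣ f) {N : ℕ} (hu : X ^ N ∣ u) :
    X ^ N ∣ u.comp f := by
  obtain ⟨w, rfl⟩ := hu
  rw [mul_comp, X_pow_comp]
  exact (pow_dvd_pow_of_dvd hf N).mul_right _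

theorem X_dvd_iterate_comp {f : R[X]} (hf : X ∣ f) (n : ℕ) : X ∣ f.comp^[n] X := by
  induction n with
  | zero => simp
  | succ n ih =>
    rw [iterate_comp_X_succ]
    simpa using X_pow_dvd_comp hf (N := 1) (by simpa using ih)

theorem map_iterate_comp {S : Type*} [CommRing S] (φ : R →+* S) (f : R[X]) (n : ℕ) :
    (f.comp^[n] X).map φ = (f.map φ).comp^[n] X := by
  induction n with
  | zero => simp
  | succ n ih => rw [Function.iterate_succ_apply', Function.iterate_succ_apply', map_comp, ih]

/-- Composing with `X + X ^ m * h` changes a polynomial by `X ^ m` times its derivative,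
to the leading order. -/
theorem X_pow_dvd_comp_sub_sub (f h : R[X]) {m : ℕ} :
    X ^ (2 * m) ∣ f.comp (X + X ^ m * h) - f - derivative f * (X ^ m * h) := by
  obtain ⟨c, hc⟩ := Polynomial.exists_mul_sq_add_linear_part_eq_eval_add
    (f.map C) X (X ^ m * h)
  have e : ∀ y, (f.map C).eval y = f.comp y := fun y => by rw [eval_map, comp]
  rw [derivative_map, e, e, eval_map, ← comp, comp_X, comp_X] at hc
  refine ⟨c * h ^ 2, ?_⟩
  rw [← hc]
  ring

theorem coeff_one_iterate_comp {f : R[X]} (hf : X ∣ f) (n : ℕ) :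
    (f.comp^[n] X).coeff 1 = f.coeff 1 ^ n := by
  induction n with
  | zero => simp
  | succ n ih =>
    obtain ⟨u, rfl⟩ := hf
    obtain ⟨w, hw⟩ := X_dvd_iterate_comp (dvd_mul_right X u) n
    rw [hw] at ih
    rw [iterate_comp_X_succ, hw, pow_succ, ← ih, mul_comp, X_comp, mul_assoc,
      show (1 : ℕ) = 0 + 1 from rfl, coeff_X_mul, coeff_X_mul, coeff_X_mul, mul_coeff_zero,
      mul_comm]
    simp [coeff_zero_eq_eval_zero, eval_comp]

/-- The `q`-th iterate of a polynomial fixing `0` with multiplier a primitive `q`-th root of unity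
is tangent to the identity to order `q`. -/
theorem X_pow_dvd_iterate_comp_sub_X [IsDomain R] {f : R[X]} (hf : X ∣ f) {q : ℕ}
    (hlam : IsPrimitiveRoot (f.coeff 1) q) (hq : 1 ≤ q) :
    X ^ (q + 1) ∣ f.comp^[q] X - X := by
  have key : ∀ m, 1 ≤ m → m ≤ q → X ^ (m + 1) ∣ f.comp^[q] X - X := by
    intro m hm
    induction m, hm using Nat.le_induction with
    | base =>
      intro _
      rw [X_pow_dvd_iff]
      intro d hd
      have h0 : (f.comp^[q] X).coeff 0 = 0 := X_dvd_iff.1 (X_dvd_iterate_comp hf q)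
      have h1 := coeff_one_iterate_comp hf q
      rw [hlam.pow_eq_one] at h1
      interval_cases d <;> simp [h0, h1]
    | succ m hm ih =>
      intro hmq
      obtain ⟨h, hh⟩ := ih (by omega)
      have hF : f.comp^[q] X = X + X ^ (m + 1) * h := by rw [← hh]; ring
      have hcomm : f.comp (f.comp^[q] X) = (f.comp^[q] X).comp f := by
        rw [← iterate_comp_X_succ, Function.iterate_succ_apply']
      obtain ⟨u, hu⟩ := hf
      have hT := X_pow_dvd_comp_sub_sub f h (m := m + 1)
      rw [← hF, hcomm, hF] at hT
      simp only [add_comp, X_comp, mul_comp, X_pow_comp] at hT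
      have hd : X ^ (m + 1) * X ∣ X ^ (m + 1) * (u ^ (m + 1) * h.comp f - derivative f * h) := by
        rw [← pow_succ]
        refine (pow_dvd_pow X (by omega : m + 1 + 1 ≤ 2 * (m + 1))).trans ?_
        refine hT.trans (dvd_of_eq ?_)
        have : f ^ (m + 1) = X ^ (m + 1) * u ^ (m + 1) := by rw [hu, mul_pow]
        rw [this]; ring
      have hd' := (mul_dvd_mul_iff_left (pow_ne_zero _ X_ne_zero)).1 hd
      rw [X_dvd_iff] at hd'
      have hu0 : u.coeff 0 = f.coeff 1 := by rw [hu, coeff_X_mul]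
      have hf0 : f.eval 0 = 0 := by rw [hu]; simp
      have hc : (h.comp f).coeff 0 = h.coeff 0 := by
        simp [coeff_zero_eq_eval_zero, eval_comp, hf0]
      have hder : (derivative f).coeff 0 = f.coeff 1 := by simp [coeff_derivative]
      have hup : (u ^ (m + 1)).coeff 0 = f.coeff 1 ^ (m + 1) := by
        rw [← hu0]; simp [coeff_zero_eq_eval_zero]
      rw [coeff_sub, mul_coeff_zero, mul_coeff_zero, hc, hder, hup] at hd'
      have hne : f.coeff 1 * (f.coeff 1 ^ m - 1) ≠ 0 :=
        mul_ne_zero (hlam.ne_zero (by omega))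
          (sub_ne_zero.2 (hlam.pow_ne_one_of_pos_of_lt (by omega) (by omega)))
      have hh0 : h.coeff 0 = 0 := by
        refine (mul_eq_zero.1 ?_).resolve_left hne
        rw [← hd']; ring
      rw [hh, pow_succ X (m + 1)]
      exact mul_dvd_mul_left _ (X_dvd_iff.2 hh0)
  exact key q hq le_rfl
end Algebra

section Pullback

/-- If `D` is an inverse of `f'` modulo a power of `X`, this is the pullback `v ↦ v ∘ f / f'` of
vector fields by `f`, truncated to that power of `X`. -/
noncomputable def pullbackField (f D : ℂ[X]) : ℂ[X] →ₗ[ℂ] ℂ[X] :=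
  LinearMap.mulLeft ℂ D ∘ₗ (aeval f).toLinearMap

theorem pullbackField_apply (f D v : ℂ[X]) : pullbackField f D v = D * v.comp f := rfl

variable {f D : ℂ[X]}

theorem X_pow_dvd_pullbackField_iterate (hf : X ∣ f) {m : ℕ} {v : ℂ[X]} (hv : X ^ m ∣ v) (n : ℕ) :
    X ^ m ∣ (pullbackField f D)^[n] v := by
  induction n with
  | zero => exact hv
  | succ n ih =>
    rw [Function.iterate_succ_apply', pullbackField_apply]
    exact (X_pow_dvd_comp hf ih).mul_left _

theorem pullbackField_iterate_mul_derivative (hf : X ∣ f) {N : ℕ}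
    (hD : X ^ N ∣ D * derivative f - 1) (v : ℂ[X]) (n : ℕ) :
    X ^ N ∣ (pullbackField f D)^[n] v * derivative (f.comp^[n] X) - v.comp (f.comp^[n] X) := by
  induction n with
  | zero => simp
  | succ n ih =>
    rw [Function.iterate_succ_apply', pullbackField_apply, iterate_comp_X_succ, derivative_comp,
      ← comp_assoc]
    have h1 := X_pow_dvd_comp hf ih
    rw [sub_comp, mul_comp] at h1
    have := (h1.mul_left (D * derivative f)).add (hD.mul_right ((v.comp (f.comp^[n] X)).comp f))
    convert this using 1
    ring

theorem coeff_pullbackField (hf : X ∣ f) {N : ℕ} (hD : X ^ (N + 1) ∣ D * derivative f - 1)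
    {m : ℕ} {v : ℂ[X]} (hv : X ^ (m + 1) ∣ v) :
    (pullbackField f D v).coeff (m + 1) = f.coeff 1 ^ m * v.coeff (m + 1) := by
  obtain ⟨w, rfl⟩ := hv
  obtain ⟨u, rfl⟩ := hf
  have hD0 : D.coeff 0 * u.coeff 0 = 1 := by
    have := X_pow_dvd_iff.1 hD 0 (by omega)
    have h1 := coeff_X_mul u 0
    rw [coeff_sub, mul_coeff_zero, coeff_derivative, h1] at this
    simpa [sub_eq_zero] using this
  have e : pullbackField (X * u) D (X ^ (m + 1) * w)
      = X ^ (m + 1) * (D * u ^ (m + 1) * w.comp (X * u)) := by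
    rw [pullbackField_apply, mul_comp, X_pow_comp]; ring
  have hc : (w.comp (X * u)).coeff 0 = w.coeff 0 := by
    simp [coeff_zero_eq_eval_zero, eval_comp]
  have hup : (u ^ (m + 1)).coeff 0 = u.coeff 0 ^ (m + 1) := by simp [coeff_zero_eq_eval_zero]
  have h1 : (X * u).coeff 1 = u.coeff 0 := coeff_X_mul u 0
  have h2 : ∀ g : ℂ[X], (X ^ (m + 1) * g).coeff (m + 1) = g.coeff 0 := fun g => by
    simpa using coeff_X_pow_mul g (m + 1) 0
  rw [e, h2, h2, h1, mul_coeff_zero, mul_coeff_zero, hc, hup]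
  linear_combination (u.coeff 0 ^ m * w.coeff 0) * hD0

theorem coeff_pullbackField_iterate (hf : X ∣ f) {N : ℕ}
    (hD : X ^ (N + 1) ∣ D * derivative f - 1)
    {m : ℕ} {v : ℂ[X]} (hv : X ^ (m + 1) ∣ v) (n : ℕ) :
    ((pullbackField f D)^[n] v).coeff (m + 1) = (f.coeff 1 ^ m) ^ n * v.coeff (m + 1) := by
  induction n with
  | zero => simp
  | succ n ih =>
    rw [Function.iterate_succ_apply',
      coeff_pullbackField hf hD (X_pow_dvd_pullbackField_iterate hf hv n), ih]
    ring

/-- The pullback by the `q`-th iterate is the identity on vector fields vanishing at `0`. -/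
theorem pullbackField_iterate_sub_self (hf : X ∣ f) {N q : ℕ}
    (hD : X ^ N ∣ D * derivative f - 1) (hg : X ^ N ∣ f.comp^[q] X - X)
    {v : ℂ[X]} (hv : X ∣ v) :
    X ^ N ∣ (pullbackField f D)^[q] v - v := by
  obtain _ | N := N
  · simp
  have h1 := pullbackField_iterate_mul_derivative hf hD v q
  obtain ⟨h, hh⟩ := hg
  obtain ⟨w, hw⟩ : X ∣ (pullbackField f D)^[q] v := by
    simpa using X_pow_dvd_pullbackField_iterate hf (m := 1) (by simpa using hv) q
  have hF : f.comp^[q] X = X + X ^ (N + 1) * h := by rw [← hh]; ring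
  have h2 : X ^ (N + 1) ∣ v.comp (f.comp^[q] X) - v := by
    rw [hF]
    have := (pow_dvd_pow X (by omega : N + 1 ≤ 2 * (N + 1))).trans (X_pow_dvd_comp_sub_sub v h)
    convert this.add (dvd_mul_right (X ^ (N + 1)) (h * derivative v)) using 1
    ring
  have h3 : X ^ (N + 1) ∣ (pullbackField f D)^[q] v * derivative (f.comp^[q] X)
      - (pullbackField f D)^[q] v := by
    rw [hF, hw]
    refine ⟨w * (((N : ℂ[X]) + 1) * h + X * derivative h), ?_⟩
    simp only [derivative_mul, derivative_X_pow, derivative_X, map_natCast, map_add, map_one,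
      Nat.cast_add, Nat.cast_one, Nat.add_sub_cancel]
    ring
  convert (h1.add h2).sub h3 using 1
  ring

/-- An averaging construction of a functional which is invariant under the pullback and kills
`X * D`. -/
theorem exists_invariant_functional (hf : X ∣ f) {q : ℕ} (hq : 1 ≤ q)
    (hlam : f.coeff 1 ^ q = 1) (hD : X ^ (q + 2) ∣ D * derivative f - 1)
    (hg : X ^ (q + 2) ∣ f.comp^[q] X - X) :
    ∃ l : ℂ[X] →ₗ[ℂ] ℂ, (∀ v, X ^ (q + 2) ∣ v → l v = 0) ∧
      (∀ v, X ∣ v → l (pullbackField f D v) = l v) ∧ l (X * D) = 0 ∧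
      (∀ v, X ^ (q + 2) ∣ ∑ j ∈ Finset.range q, (pullbackField f D)^[j] v → l v = 0) ∧
      ∃ v, X ∣ v ∧ l v ≠ 0 := by
  set A := pullbackField f D
  let P : ℂ[X] →ₗ[ℂ] ℂ[X] := ∑ j ∈ Finset.range q, A ^ j
  have hP : ∀ v, P v = ∑ j ∈ Finset.range q, A^[j] v := fun v => by
    simp [P, Module.End.pow_apply]
  obtain ⟨α, β, hne, hαβ⟩ : ∃ α β : ℂ, (α ≠ 0 ∨ β ≠ 0) ∧
      α * (P (X * D)).coeff 1 + β * (P (X * D)).coeff (q + 1) = 0 := by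
    by_cases h : (P (X * D)).coeff (q + 1) = 0
    · exact ⟨0, 1, by simp, by simp [h]⟩
    · exact ⟨(P (X * D)).coeff (q + 1), -(P (X * D)).coeff 1, .inl h, by ring⟩
  let l : ℂ[X] →ₗ[ℂ] ℂ := (α • lcoeff ℂ 1 + β • lcoeff ℂ (q + 1)) ∘ₗ P
  have hl : ∀ v, l v = α * (P v).coeff 1 + β * (P v).coeff (q + 1) := fun v => by simp [l]
  have hl0 : ∀ v, X ^ (q + 2) ∣ P v → l v = 0 := fun v hv => by
    rw [X_pow_dvd_iff] at hv
    rw [hl, hv 1 (by omega), hv (q + 1) (by omega)]; simp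
  refine ⟨l, fun v hv => hl0 v ?_, fun v hv => ?_, ?_, fun v hv => hl0 v ?_, ?_⟩
  · rw [hP]
    exact Finset.dvd_sum fun j _ => X_pow_dvd_pullbackField_iterate hf hv j
  · rw [← sub_eq_zero, ← map_sub]
    apply hl0
    rw [map_sub, hP, hP]
    simp only [← Function.iterate_succ_apply]
    rw [← Finset.sum_sub_distrib, Finset.sum_range_sub (fun j => A^[j] v)]
    exact pullbackField_iterate_sub_self hf hD hg hv
  · rw [hl, hαβ]
  · rwa [hP]
  · have hlX : l (X ^ (q + 1)) = q * β := by
      have h1 : (P (X ^ (q + 1))).coeff 1 = 0 := by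
        rw [hP, finsetSum_coeff]
        exact Finset.sum_eq_zero fun j _ =>
          X_pow_dvd_iff.1 (X_pow_dvd_pullbackField_iterate hf dvd_rfl j) 1 (by omega)
      have h2 : (P (X ^ (q + 1))).coeff (q + 1) = q := by
        rw [hP, finsetSum_coeff]
        simp [A, coeff_pullbackField_iterate hf hD dvd_rfl, hlam]
      rw [hl, h1, h2]; ring
    have hq0 : (q : ℂ) ≠ 0 := by exact_mod_cast (by omega : q ≠ 0)
    by_cases hβ : β = 0
    · refine ⟨X, dvd_rfl, ?_⟩
      have h2 : (P X).coeff 1 = q := by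
        rw [hP, finsetSum_coeff]
        have := coeff_pullbackField_iterate hf (m := 0) hD (v := X) (by simp)
        simp [A, this]
      rw [hl, h2, hβ]
      simpa [hq0, hβ] using hne
    · exact ⟨X ^ (q + 1), dvd_pow_self _ (by omega), by rw [hlX]; exact mul_ne_zero hq0 hβ⟩

end Pullback

section Pushforward

/-- The truncation to degree less than `N` of the power series of `1 / (z - X)`. -/
noncomputable def truncKernel (N : ℕ) (z : ℂ) : ℂ[X] :=
  ∑ n ∈ Finset.range N, C (z⁻¹ ^ (n + 1)) * X ^ n

theorem sub_mul_truncKernel (N : ℕ) {z : ℂ} (hz : z ≠ 0) :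
    (C z - X) * truncKernel N z = 1 - X ^ N * C (z⁻¹ ^ N) := by
  induction N with
  | zero => simp [truncKernel]
  | succ N ih =>
    rw [truncKernel, Finset.sum_range_succ, ← truncKernel, mul_add, ih]
    have : C z * C z⁻¹ = 1 := by rw [← C_mul, mul_inv_cancel₀ hz, C_1]
    simp only [C_pow]
    linear_combination (C z⁻¹ ^ N * X ^ N) * this

variable {f D : ℂ[X]}

/-- Partial fractions of `1 / (w - f)`, truncated. -/
theorem X_pow_dvd_truncKernel_comp_sub (hf : X ∣ f) (hm : f.Monic) (N : ℕ) {w : ℂ} (hw : w ≠ 0)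
    (hd : 0 < f.natDegree)
    (hcrit : ∀ z, f.eval z = w → (derivative f).eval z ≠ 0) :
    X ^ N ∣ (truncKernel N w).comp f - ∑ z ∈ (f - C w).roots.toFinset,
      C ((derivative f).eval z)⁻¹ * truncKernel N z := by
  classical
  set s := (f - C w).roots.toFinset with hs
  have hdeg : (C w).degree < f.degree :=
    degree_C_le.trans_lt (natDegree_pos_iff_degree_pos.1 hd)
  have hmw : (f - C w).Monic := hm.sub_of_left hdeg
  have hmem : ∀ z, z ∈ s ↔ f.eval z = w := fun z => by
    simp [hs, mem_roots hmw.ne_zero, sub_eq_zero]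
  have hf0 : f.eval 0 = 0 := by obtain ⟨u, rfl⟩ := hf; simp
  have hnodup : (f - C w).roots.Nodup := by
    rw [Multiset.nodup_iff_count_le_one]
    intro z
    rw [count_roots]
    by_contra! h
    rw [one_lt_rootMultiplicity_iff_isRoot hmw.ne_zero] at h
    obtain ⟨h1, h2⟩ := h
    refine hcrit z ?_ ?_
    · simpa [sub_eq_zero] using h1
    · simpa using h2
  have hnodal : Lagrange.nodal s id = f - C w := by
    conv_rhs => rw [(IsAlgClosed.splits (f - C w)).eq_prod_roots_of_monic hmw]
    rw [Lagrange.nodal, hs, Finset.prod_eq_multiset_prod, Multiset.toFinset_val,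
      hnodup.dedup]
    simp
  have hne : s.Nonempty := by
    obtain ⟨z, hz⟩ := IsAlgClosed.exists_root (f - C w) (by
      rw [degree_sub_eq_left_of_degree_lt hdeg]
      exact (natDegree_pos_iff_degree_pos.1 hd).ne')
    exact ⟨z, (hmem z).2 (by simpa [sub_eq_zero] using hz)⟩
  have hsum : ∑ z ∈ s, C ((derivative f).eval z)⁻¹ * ((f - C w) / (X - C z)) = 1 := by
    rw [← Lagrange.sum_basis (v := id) (Set.injOn_id _) hne]
    refine Finset.sum_congr rfl fun z hz => ?_
    rw [Lagrange.basis_eq_prod_sub_inv_mul_nodal_div hz,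
      Lagrange.nodalWeight_eq_eval_derivative_nodal hz, hnodal]
    simp
  have hX : ¬ X ∣ C w - f := by
    rw [X_dvd_iff]
    simpa [coeff_zero_eq_eval_zero, hf0] using hw
  refine prime_X.pow_dvd_of_dvd_mul_left N hX ?_
  have h1 : (C w - f) * (truncKernel N w).comp f = 1 - f ^ N * C (w⁻¹ ^ N) := by
    have := congr_arg (fun p => p.comp f) (sub_mul_truncKernel N hw)
    simpa only [mul_comp, sub_comp, C_comp, X_comp, one_comp, X_pow_comp] using this
  have h2 : ∀ z ∈ s, (C w - f) * (C ((derivative f).eval z)⁻¹ * truncKernel N z)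
      = C ((derivative f).eval z)⁻¹ * ((f - C w) / (X - C z))
        - X ^ N * (C (z⁻¹ ^ N) * (C ((derivative f).eval z)⁻¹ * ((f - C w) / (X - C z)))) := by
    intro z hz
    have hz' := (hmem z).1 hz
    have hz0 : z ≠ 0 := by
      rintro rfl
      exact hw (hz'.symm.trans hf0)
    have hdiv : (X - C z) * ((f - C w) / (X - C z)) = f - C w :=
      mul_div_eq_iff_isRoot.2 (by simp [hz'])
    have h3 := sub_mul_truncKernel N hz0
    linear_combination (C ((derivative f).eval z)⁻¹ * truncKernel N z) * hdiv +
      (C ((derivative f).eval z)⁻¹ * ((f - C w) / (X - C z))) * h3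
  rw [mul_sub, h1, Finset.mul_sum, Finset.sum_congr rfl h2, Finset.sum_sub_distrib, hsum,
    ← Finset.mul_sum]
  have h4 : X ^ N ∣ f ^ N := pow_dvd_pow_of_dvd hf N
  rw [sub_sub_sub_cancel_left]
  exact (dvd_mul_right (X ^ N) _).sub (h4.mul_right (C (w⁻¹ ^ N)))

/-- A functional `l` gives a function `z ↦ l (truncKernel N z)`; if `l` is invariant under
pullback of vector fields, the corresponding quadratic differential is
invariant under pushforward. -/
theorem pushforward_eq_self (hf : X ∣ f) (hm : f.Monic) (hd : 2 ≤ f.natDegree) {N : ℕ}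
    (hD : X ^ N ∣ D * derivative f - 1) {l : ℂ[X] →ₗ[ℂ] ℂ}
    (hlN : ∀ v, X ^ N ∣ v → l v = 0) (hl : ∀ v, l (pullbackField f D v) = l v)
    (hlD : ∀ k, k + 1 < f.natDegree → l (X ^ k * D) = 0) {w : ℂ} (hw : w ≠ 0)
    (hcrit : ∀ z, f.eval z = w → (derivative f).eval z ≠ 0) :
    l (truncKernel N w) = ∑ z ∈ (f - C w).roots.toFinset,
      ((derivative f).eval z ^ 2)⁻¹ * l (truncKernel N z) := by
  have hlC : ∀ (a : ℂ) (v : ℂ[X]), l (C a * v) = a * l v := fun a v => by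
    rw [← smul_eq_C_mul, map_smul, smul_eq_mul]
  have hlG : ∀ G : ℂ[X], G.natDegree + 1 < f.natDegree → l (D * G) = 0 := by
    intro G hG
    rw [G.as_sum_range_C_mul_X_pow, Finset.mul_sum, map_sum]
    refine Finset.sum_eq_zero fun k hk => ?_
    rw [show D * (C (G.coeff k) * X ^ k) = C (G.coeff k) * (X ^ k * D) by ring, hlC,
      hlD k (by have := Finset.mem_range.1 hk; omega), mul_zero]
  have hdiff : ∀ z, z ≠ 0 →
      l (truncKernel N z) = (derivative f).eval z * l (D * truncKernel N z) := by
    intro z hz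
    obtain ⟨G, hG⟩ : X - C z ∣ derivative f - C ((derivative f).eval z) :=
      X_sub_C_dvd_sub_C_eval
    have hGdeg : G.natDegree + 1 < f.natDegree := by
      have h1 : (derivative f - C ((derivative f).eval z)).natDegree < f.natDegree := by
        rw [natDegree_sub_C]
        exact natDegree_derivative_lt (by omega)
      by_cases hG0 : G = 0
      · rw [hG0, natDegree_zero]; omega
      · rw [hG, natDegree_mul (X_sub_C_ne_zero z) hG0, natDegree_X_sub_C] at h1
        omega
    have h2 := sub_mul_truncKernel N hz
    have h3 : truncKernel N z = C ((derivative f).eval z) * (D * truncKernel N z)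
        - D * G + (X ^ N * (D * G * C (z⁻¹ ^ N)) -
          (D * derivative f - 1) * truncKernel N z) := by
      linear_combination D * truncKernel N z * hG - D * G * h2
    rw [congr_arg l h3, map_add, map_sub, hlC, hlG G hGdeg,
      hlN _ ((dvd_mul_right _ _).sub (hD.mul_right _))]
    ring
  have hf0 : f.eval 0 = 0 := by obtain ⟨u, rfl⟩ := hf; simp
  have hK := hlN _ ((X_pow_dvd_truncKernel_comp_sub hf hm N hw (by omega) hcrit).mul_left D)
  rw [mul_sub, map_sub, ← pullbackField_apply, hl, sub_eq_zero] at hK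
  rw [hK, Finset.mul_sum, map_sum]
  refine Finset.sum_congr rfl fun z hz => ?_
  have hz' : f.eval z = w := by
    simpa [sub_eq_zero] using (mem_roots'.1 (Multiset.mem_toFinset.1 hz)).2
  have hz0 : z ≠ 0 := by
    rintro rfl
    exact hw (hz'.symm.trans hf0)
  have hne := hcrit z hz'
  rw [hdiff z hz0, mul_left_comm, hlC]
  field_simp

end Pushforward

section Area

open MeasureTheory Set

theorem det_toSpanSingleton_restrictScalars (c : ℂ) :
    ((ContinuousLinearMap.toSpanSingleton ℂ c).restrictScalars ℝ).det = ‖c‖ ^ 2 := by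
  rw [← Complex.normSq_eq_norm_sq, ← Algebra.norm_complex_apply, Algebra.norm_apply]
  refine congr_arg LinearMap.det (LinearMap.ext fun z => ?_)
  simp [mul_comm]

/-- If a density is pointwise at most its pushforward by a polynomial `f`, then the mass of a
set is at most that of its preimage. -/
theorem setLIntegral_le_setLIntegral_preimage {f : ℂ[X]} (hf : derivative f ≠ 0)
    {ρ : ℂ → ENNReal} (hρm : Measurable ρ)
    (hρ : ∀ w, w ≠ 0 → (∀ z, f.eval z = w → (derivative f).eval z ≠ 0) →
      ρ w ≤ ∑ z ∈ (f - C w).roots.toFinset,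
        ρ z * (ENNReal.ofReal (‖(derivative f).eval z‖ ^ 2))⁻¹)
    {A : Set ℂ} (hA : MeasurableSet A) :
    ∫⁻ z in A, ρ z ≤ ∫⁻ z in (fun z => f.eval z) ⁻¹' A, ρ z := by
  classical
  set F : ℂ → ℂ := fun z => f.eval z with hF
  have hFc : Continuous F := f.continuous
  set Z : Set ℂ := {z | (derivative f).eval z ≠ 0} with hZ
  have hZo : IsOpen Z := isOpen_ne_fun (derivative f).continuous continuous_const
  set k : ℂ → ENNReal := fun z => ρ z * (ENNReal.ofReal (‖(derivative f).eval z‖ ^ 2))⁻¹ with hk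
  have hkm : Measurable k := by
    refine hρm.mul (Measurable.inv (ENNReal.measurable_ofReal.comp ?_))
    exact ((derivative f).continuous.norm.pow 2).measurable
  have hloc : ∀ z ∈ Z, ∃ U, IsOpen U ∧ z ∈ U ∧ InjOn F U := by
    intro z hz
    have h := (f.hasStrictDerivAt z).hasStrictFDerivAt_equiv hz
    refine ⟨(h.toOpenPartialHomeomorph F).source, (h.toOpenPartialHomeomorph F).open_source,
      h.mem_toOpenPartialHomeomorph_source, (h.toOpenPartialHomeomorph F).injOn⟩
  choose! U hUo hUz hUi using hloc
  obtain ⟨t, htZ, htc, htU⟩ := TopologicalSpace.countable_cover_nhdsWithin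
    (s := Z) (f := U) fun z hz => mem_nhdsWithin_of_mem_nhds ((hUo z hz).mem_nhds (hUz z hz))
  have htU' : Z ⊆ ⋃ z ∈ t, U z := htU
  obtain ⟨V, hVm, hVi, hVd, hVU⟩ : ∃ V : ℕ → Set ℂ, (∀ n, MeasurableSet (V n)) ∧
      (∀ n, InjOn F (V n)) ∧ Pairwise (Function.onFun Disjoint V) ∧ ⋃ n, V n = Z := by
    obtain ⟨W, hW⟩ := ((htc.image U).insert ∅).exists_eq_range (insert_nonempty _ _)
    have hW' : ∀ n, IsOpen (W n) ∧ InjOn F (W n) := fun n => by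
      have : W n ∈ insert ∅ (U '' t) := hW ▸ mem_range_self n
      obtain h | ⟨z, hz, h⟩ := this
      · rw [h]; exact ⟨isOpen_empty, injOn_empty F⟩
      · rw [← h]; exact ⟨hUo z (htZ hz), hUi z (htZ hz)⟩
    refine ⟨fun n => disjointed W n ∩ Z, fun n => ?_, fun n => ?_, fun i j hij => ?_, ?_⟩
    · exact (MeasurableSet.disjointed (fun i => (hW' i).1.measurableSet) n).inter hZo.measurableSet
    · exact (hW' n).2.mono (inter_subset_left.trans (disjointed_subset W n))
    · exact (disjoint_disjointed W hij).mono inter_subset_left inter_subset_left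
    · rw [← iUnion_inter, iUnion_disjointed, inter_eq_right]
      intro z hz
      obtain ⟨y, hy, hzy⟩ := mem_iUnion₂.1 (htU' hz)
      obtain ⟨n, hn⟩ : U y ∈ range W := hW ▸ mem_insert_of_mem _ (mem_image_of_mem U hy)
      exact mem_iUnion_of_mem n (hn ▸ hzy)
  set g : ℕ → ℂ → ENNReal := fun n => Function.extend ((V n).domRestrict F) (fun x => k x) 0 with hg
  have hemb : ∀ n, MeasurableEmbedding ((V n).domRestrict F) := fun n =>
    (hFc.continuousOn).measurableEmbedding (hVm n) (hVi n)
  have hgm : ∀ n, Measurable (g n) := fun n =>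
    (hemb n).measurable_extend (hkm.comp measurable_subtype_coe) measurable_const
  have hgV : ∀ n, ∀ z ∈ V n, g n (F z) = k z := fun n z hz =>
    (hemb n).injective.extend_apply (fun x : V n => k x) 0 ⟨z, hz⟩
  have hg0 : ∀ n, ∀ w ∉ F '' V n, g n w = 0 := fun n w hw => by
    refine Function.extend_apply' _ _ _ ?_
    rintro ⟨x, hx⟩
    exact hw ⟨x, x.2, hx⟩
  have hint : ∀ n, ∫⁻ w in A, g n w = ∫⁻ z in V n ∩ F ⁻¹' A, ρ z := by
    intro n
    have hmeas : MeasurableSet (V n ∩ F ⁻¹' A) := (hVm n).inter (hFc.measurable hA)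
    have h1 := lintegral_image_eq_lintegral_abs_det_fderiv_mul volume hmeas (f := F)
      (f' := fun z => (ContinuousLinearMap.toSpanSingleton ℂ
        ((derivative f).eval z)).restrictScalars ℝ)
      (fun z _ => ((f.hasDerivAt z).hasFDerivAt.restrictScalars ℝ).hasFDerivWithinAt)
      ((hVi n).mono inter_subset_left) (g n)
    rw [image_inter_preimage] at h1
    have h2 : ∫⁻ w in A, g n w = ∫⁻ w in F '' V n ∩ A, g n w := by
      have hr : MeasurableSet (F '' V n) := by
        simpa [Set.range_domRestrict] using (hemb n).measurableSet_range
      rw [← lintegral_inter_add_sdiff (g n) A hr, inter_comm,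
        setLIntegral_congr_fun (hA.diff hr) (fun w hw => hg0 n w hw.2), lintegral_zero, add_zero]
    rw [h2, h1]
    refine setLIntegral_congr_fun hmeas fun z hz => ?_
    have hzZ : z ∈ Z := by rw [← hVU]; exact mem_iUnion_of_mem n hz.1
    have hpos : 0 < ‖(derivative f).eval z‖ ^ 2 := by
      have := norm_pos_iff.2 hzZ
      positivity
    rw [hgV n z hz.1, det_toSpanSingleton_restrictScalars, abs_of_pos hpos, hk, mul_left_comm,
      ENNReal.mul_inv_cancel (ENNReal.ofReal_pos.2 hpos).ne' ENNReal.ofReal_ne_top, mul_one]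
  have hae : ∀ᵐ w, ρ w ≤ ∑' n, g n w := by
    have hfin : (insert 0 (F '' {z | (derivative f).eval z = 0})).Finite := by
      refine (Set.Finite.image _ ?_).insert _
      refine (derivative f).roots.toFinset.finite_toSet.subset fun z hz => ?_
      simpa [mem_roots hf] using hz
    have hnull : volume (insert 0 (F '' {z | (derivative f).eval z = 0})) = 0 :=
      hfin.measure_zero _
    filter_upwards [measure_eq_zero_iff_ae_notMem.1 hnull] with w hw
    rw [mem_insert_iff, not_or] at hw
    have hcrit : ∀ z, f.eval z = w → (derivative f).eval z ≠ 0 := fun z hz h =>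
      hw.2 ⟨z, h, hz⟩
    refine (hρ w hw.1 hcrit).trans ?_
    have hroot : ∀ z ∈ (f - C w).roots.toFinset, F z = w := fun z hz => by
      simpa [sub_eq_zero] using (mem_roots'.1 (Multiset.mem_toFinset.1 hz)).2
    have hidx : ∀ z ∈ (f - C w).roots.toFinset, ∃ n, z ∈ V n := fun z hz => by
      have : z ∈ Z := hcrit z (hroot z hz)
      rw [← hVU] at this
      exact mem_iUnion.1 this
    choose! n hn using hidx
    calc ∑ z ∈ (f - C w).roots.toFinset, k z
        = ∑ z ∈ (f - C w).roots.toFinset, g (n z) w := Finset.sum_congr rfl fun z hz => by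
          rw [← hgV (n z) z (hn z hz), hroot z hz]
      _ = ∑ m ∈ (f - C w).roots.toFinset.image n, g m w := by
          refine (Finset.sum_image (f := fun m => g m w) fun x hx y hy hxy => ?_).symm
          refine hVi (n x) (hn x hx) (hxy ▸ hn y hy) ?_
          rw [hroot x hx, hroot y hy]
      _ ≤ ∑' m, g m w := ENNReal.sum_le_tsum _
  calc ∫⁻ z in A, ρ z ≤ ∫⁻ w in A, ∑' n, g n w := lintegral_mono_ae (ae_restrict_of_ae hae)
    _ = ∑' n, ∫⁻ w in A, g n w := lintegral_tsum fun n => (hgm n).aemeasurable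
    _ = ∑' n, ∫⁻ z in V n ∩ F ⁻¹' A, ρ z := by simp_rw [hint]
    _ = ∫⁻ z in ⋃ n, V n ∩ F ⁻¹' A, ρ z := by
        refine (lintegral_iUnion (fun n => (hVm n).inter (hFc.measurable hA)) ?_ _).symm
        exact fun i j hij => (hVd hij).mono inter_subset_left inter_subset_left
    _ ≤ ∫⁻ z in F ⁻¹' A, ρ z :=
        lintegral_mono_set (iUnion_subset fun n => inter_subset_right)

end Area

section Contraction

open MeasureTheory Set Filter Topology

theorem exists_forall_norm_add_one_le {f : ℂ[X]} (hf : X ∣ f) (hd : 2 ≤ f.natDegree) :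
    ∃ R : ℝ, 1 ≤ R ∧ ∀ z : ℂ, R ≤ ‖z‖ → ‖z‖ + 1 ≤ ‖f.eval z‖ := by
  obtain ⟨u, rfl⟩ := hf
  have hu : u ≠ 0 := by rintro rfl; simp at hd
  rw [natDegree_X_mul hu] at hd
  have ht := u.tendsto_norm_atTop (natDegree_pos_iff_degree_pos.1 (by omega))
    (z := fun x : ℂ => x) tendsto_norm_cobounded_atTop
  obtain ⟨R, -, hR⟩ := (hasBasis_cobounded_norm.eventually_iff).1 (ht.eventually_ge_atTop 2)
  refine ⟨max R 1, le_max_right _ _, fun z hz => ?_⟩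
  have h1 : 1 ≤ ‖z‖ := (le_max_right _ _).trans hz
  have h2 : 2 ≤ ‖u.eval z‖ := hR ((le_max_left _ _).trans hz)
  rw [eval_mul, eval_X, norm_mul]
  nlinarith

theorem exists_forall_norm_eval_le {g : ℂ[X]} {N : ℕ} (hg : X ^ N ∣ g - X) :
    ∃ M : ℝ, 0 < M ∧ ∀ z : ℂ, ‖z‖ ≤ 1 → ‖g.eval z‖ ≤ ‖z‖ + M * ‖z‖ ^ N := by
  obtain ⟨h, hh⟩ := hg
  obtain ⟨M, hM⟩ := (isCompact_closedBall (0 : ℂ) 1).exists_bound_of_continuousOn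
    h.continuous.continuousOn
  refine ⟨max M 1, by positivity, fun z hz => ?_⟩
  have e : g.eval z = z + z ^ N * h.eval z := by
    have := congr_arg (eval z) hh
    simp only [eval_sub, eval_X, eval_mul, eval_pow] at this
    linear_combination this
  rw [e]
  refine (norm_add_le _ _).trans (add_le_add_right ?_ _)
  rw [norm_mul, norm_pow, mul_comm]
  have := (hM z (by simpa using hz)).trans (le_max_left M 1)
  gcongr

theorem setLIntegral_le_setLIntegral_iterate_preimage {f : ℂ[X]} {ρ : ℂ → ENNReal}
    (h : ∀ A, MeasurableSet A → ∫⁻ z in A, ρ z ≤ ∫⁻ z in (fun z => f.eval z) ⁻¹' A, ρ z)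
    (n : ℕ) {A : Set ℂ} (hA : MeasurableSet A) :
    ∫⁻ z in A, ρ z ≤ ∫⁻ z in (fun z => (f.comp^[n] X).eval z) ⁻¹' A, ρ z := by
  induction n generalizing A with
  | zero => simp
  | succ n ih =>
    refine (ih hA).trans ((h _ ((f.comp^[n] X).continuous.measurable hA)).trans_eq ?_)
    rw [iterate_comp_X_succ]
    simp only [eval_comp]
    rfl

theorem volume_ball_sdiff_ball_le {r t : ℝ} (hr : 0 ≤ r) (ht : 0 ≤ t) (htr : t ≤ r) :
    volume (Metric.ball (0 : ℂ) r \ Metric.ball 0 (r - t)) ≤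
      ENNReal.ofReal (2 * Real.pi * r * t) := by
  rw [measure_sdiff (Metric.ball_subset_ball (by linarith)) measurableSet_ball.nullMeasurableSet
    measure_ball_lt_top.ne, Complex.volume_ball, Complex.volume_ball]
  have hpi : (NNReal.pi : ENNReal) = ENNReal.ofReal Real.pi := by
    rw [← NNReal.coe_real_pi, ENNReal.ofReal_coe_nnreal]
  rw [hpi, ← ENNReal.ofReal_pow hr, ← ENNReal.ofReal_pow (by linarith),
    ← ENNReal.ofReal_mul (by positivity), ← ENNReal.ofReal_mul (by positivity),
    ← ENNReal.ofReal_sub _ (by positivity)]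
  refine ENNReal.ofReal_le_ofReal ?_
  nlinarith [mul_nonneg Real.pi_pos.le (sq_nonneg t)]

/-- A polynomial tangent to the identity to order `N` at `0` expands no density with a pole of
order at most `N` at `0`. -/
theorem setLIntegral_eq_zero_of_le_preimage {g : ℂ[X]} {N : ℕ} (hN : 2 ≤ N)
    (hg : X ^ N ∣ g - X) {R : ℝ} (hR : 1 ≤ R) (hgR : ∀ z : ℂ, R ≤ ‖z‖ → ‖z‖ + 1 ≤ ‖g.eval z‖)
    {φ : ℂ → ℂ} (hφc : ContinuousOn φ {0}ᶜ) {M : ℝ}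
    (hφ : ∀ z, z ≠ 0 → ‖z‖ ≤ 1 → ‖φ z‖ ≤ M * ‖z‖⁻¹ ^ N)
    (h : ∀ A, MeasurableSet A →
      ∫⁻ z in A, ‖φ z‖ₑ ≤ ∫⁻ z in (fun z => g.eval z) ⁻¹' A, ‖φ z‖ₑ) :
    ∫⁻ z in Metric.closedBall (0 : ℂ) (R + 1) \ Metric.closedBall 0 R, ‖φ z‖ₑ = 0 := by
  obtain ⟨M', hM', hgM⟩ := exists_forall_norm_eval_le hg
  have hM : 0 ≤ M := by simpa using (norm_nonneg _).trans (hφ 1 one_ne_zero (by simp))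
  have key : ∀ r : ℝ, 0 < r → r ≤ 1 → M' * r ^ (N - 1) ≤ 1 / 2 →
      ∫⁻ z in Metric.closedBall (0 : ℂ) (R + 1) \ Metric.closedBall 0 R, ‖φ z‖ₑ ≤
        ENNReal.ofReal (M * 2 ^ N * (2 * Real.pi * M') * r) := by
    intro r hr hr1 hrM
    have hrN : r ^ N = r ^ (N - 1) * r := by rw [← pow_succ]; congr 1; omega
    set t := M' * r ^ N with ht
    have ht0 : 0 < t := by positivity
    have htr : t ≤ r / 2 := by rw [ht, hrN]; nlinarith
    set K := Metric.closedBall (0 : ℂ) (R + 1) \ Metric.closedBall 0 R with hK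
    set mid := Metric.closedBall (0 : ℂ) R \ Metric.ball 0 r with hmid
    set inn := Metric.ball (0 : ℂ) r \ Metric.ball 0 (r - t) with hinn
    have hmidm : MeasurableSet mid := measurableSet_closedBall.diff measurableSet_ball
    have hinnm : MeasurableSet inn := measurableSet_ball.diff measurableSet_ball
    have hKm : MeasurableSet K := measurableSet_closedBall.diff measurableSet_closedBall
    have hKmid : Disjoint K mid := disjoint_left.2 fun z hz hz' => hz.2 hz'.1
    have hinnmid : Disjoint inn mid := disjoint_left.2 fun z hz hz' => hz'.2 hz.1
    have hsub : (fun z => g.eval z) ⁻¹' (K ∪ mid) ⊆ inn ∪ mid := by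
      intro z hz
      have hz' : ‖g.eval z‖ ≤ R + 1 ∧ r ≤ ‖g.eval z‖ := by
        simp only [hK, hmid, mem_preimage, mem_union, Set.mem_sdiff, mem_closedBall_zero_iff,
          mem_ball_zero_iff, not_le, not_lt] at hz
        obtain hz | hz := hz <;> constructor <;> linarith
      have h1 : ‖z‖ ≤ R := by
        by_contra! hc
        linarith [hgR z hc.le]
      have h2 : r - t ≤ ‖z‖ := by
        by_contra! hc
        have h3 : ‖z‖ ^ N ≤ r ^ N := by gcongr; linarith
        have h4 := hgM z (by linarith)
        have h5 : M' * ‖z‖ ^ N ≤ t := by rw [ht]; gcongr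
        linarith
      simp only [hinn, hmid, mem_union, Set.mem_sdiff, mem_closedBall_zero_iff,
          mem_ball_zero_iff, not_lt]
      obtain h6 | h6 := lt_or_ge ‖z‖ r
      · exact .inl ⟨h6, h2⟩
      · exact .inr ⟨h1, h6⟩
    have hfin : ∫⁻ z in mid, ‖φ z‖ₑ ≠ ⊤ := by
      have hcpt : IsCompact mid := (isCompact_closedBall 0 R).diff Metric.isOpen_ball
      have : IntegrableOn φ mid := by
        refine ContinuousOn.integrableOn_compact hcpt (hφc.mono fun z hz hz0 => hz.2 ?_)
        rw [mem_singleton_iff.1 hz0]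
        exact Metric.mem_ball_self hr
      exact this.2.ne
    have hle := (h _ (hKm.union hmidm)).trans (lintegral_mono_set hsub)
    rw [lintegral_union hmidm hKmid, lintegral_union hmidm hinnmid,
      ENNReal.add_le_add_iff_right hfin] at hle
    refine hle.trans ?_
    calc ∫⁻ z in inn, ‖φ z‖ₑ ≤ ∫⁻ z in inn, ENNReal.ofReal (M * (2 / r) ^ N) := by
          refine setLIntegral_mono' hinnm fun z hz => ?_
          simp only [hinn, Set.mem_sdiff, mem_ball_zero_iff, not_lt] at hz
          have hz2 : r / 2 ≤ ‖z‖ := by linarith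
          have hz0 : z ≠ 0 := norm_pos_iff.1 (by linarith)
          rw [← ofReal_norm]
          refine ENNReal.ofReal_le_ofReal ((hφ z hz0 (by linarith)).trans ?_)
          have : ‖z‖⁻¹ ≤ 2 / r := by
            rw [← inv_div]
            gcongr
          gcongr
      _ = ENNReal.ofReal (M * (2 / r) ^ N) * volume inn := setLIntegral_const _ _
      _ ≤ ENNReal.ofReal (M * (2 / r) ^ N) * ENNReal.ofReal (2 * Real.pi * r * t) := by
          gcongr
          exact volume_ball_sdiff_ball_le hr.le ht0.le (by linarith)
      _ = _ := by
          rw [← ENNReal.ofReal_mul (by positivity), ht]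
          congr 1
          rw [div_pow]
          field_simp
  have hlim : Tendsto (fun r : ℝ => ENNReal.ofReal (M * 2 ^ N * (2 * Real.pi * M') * r))
      (𝓝[>] 0) (𝓝 0) := by
    have : Tendsto (fun r : ℝ => ENNReal.ofReal (M * 2 ^ N * (2 * Real.pi * M') * r))
        (𝓝 0) (𝓝 (ENNReal.ofReal (M * 2 ^ N * (2 * Real.pi * M') * 0))) :=
      ((ENNReal.continuous_ofReal.comp (continuous_const.mul continuous_id)).tendsto 0)
    rw [mul_zero, ENNReal.ofReal_zero] at this
    exact this.mono_left nhdsWithin_le_nhds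
  have hsmall : ∀ᶠ r : ℝ in 𝓝[>] 0, M' * r ^ (N - 1) < 1 / 2 := by
    have : Tendsto (fun r : ℝ => M' * r ^ (N - 1)) (𝓝 0) (𝓝 (M' * 0 ^ (N - 1))) :=
      (continuous_const.mul (continuous_id.pow (N - 1))).tendsto 0
    rw [zero_pow (by omega), mul_zero] at this
    exact (this.mono_left nhdsWithin_le_nhds).eventually_lt_const (by norm_num)
  refine le_antisymm (ge_of_tendsto hlim ?_) zero_le
  filter_upwards [hsmall, Ioc_mem_nhdsGT (zero_lt_one' ℝ)] with r h1 h2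
  exact key r h2.1 h2.2 h1.le

theorem apply_truncKernel (l : ℂ[X] →ₗ[ℂ] ℂ) (N : ℕ) (z : ℂ) :
    l (truncKernel N z) = ∑ n ∈ Finset.range N, z⁻¹ ^ (n + 1) * l (X ^ n) := by
  rw [truncKernel, map_sum]
  refine Finset.sum_congr rfl fun n _ => ?_
  rw [← smul_eq_C_mul, map_smul, smul_eq_mul]

/-- The functions `z ↦ l (truncKernel N z)` have only finitely many zeros outside `0`. -/
theorem finite_setOf_apply_truncKernel_eq_zero {l : ℂ[X] →ₗ[ℂ] ℂ} {N : ℕ} {n : ℕ} (hn : n < N)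
    (hl : l (X ^ n) ≠ 0) : {z : ℂ | z ≠ 0 ∧ l (truncKernel N z) = 0}.Finite := by
  set p : ℂ[X] := ∑ k ∈ Finset.range N, C (l (X ^ k)) * X ^ (N - 1 - k) with hp
  have hp0 : p ≠ 0 := by
    intro h
    have hc : p.coeff (N - 1 - n) = l (X ^ n) := by
      rw [hp, finsetSum_coeff, Finset.sum_eq_single n]
      · simp
      · intro k hk hkn
        have := Finset.mem_range.1 hk
        rw [coeff_C_mul_X_pow, if_neg (by omega)]
      · simp [hn]
    rw [h, coeff_zero] at hc
    exact hl hc.symm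
  refine p.roots.toFinset.finite_toSet.subset ?_
  rintro z ⟨hz, hz0⟩
  simp only [Finset.mem_coe, Multiset.mem_toFinset, mem_roots hp0, IsRoot.def]
  have : p.eval z = z ^ N * l (truncKernel N z) := by
    rw [hp, eval_finsetSum, apply_truncKernel, Finset.mul_sum]
    refine Finset.sum_congr rfl fun k hk => ?_
    have := Finset.mem_range.1 hk
    have hpow : z ^ N = z ^ (N - 1 - k) * z ^ (k + 1) := by
      rw [← pow_add]; congr 1; omega
    rw [hpow]
    simp only [eval_mul, eval_C, eval_pow, eval_X, inv_pow]
    field_simp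
  rw [this, hz0, mul_zero]

/-- There is no nonzero quadratic differential with a pole of order at most `N` at `0` which is
invariant under pushforward by a polynomial with an iterate tangent to the identity to
order `N`. -/
theorem apply_X_pow_eq_zero_of_pushforward_eq_self {f : ℂ[X]} (hf : X ∣ f)
    (hd : 2 ≤ f.natDegree) {N q : ℕ} (hN : 2 ≤ N) (hq : 1 ≤ q)
    (hg : X ^ N ∣ f.comp^[q] X - X) {l : ℂ[X] →ₗ[ℂ] ℂ}
    (hl : ∀ w, w ≠ 0 → (∀ z, f.eval z = w → (derivative f).eval z ≠ 0) →
      l (truncKernel N w) = ∑ z ∈ (f - C w).roots.toFinset,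
        ((derivative f).eval z ^ 2)⁻¹ * l (truncKernel N z))
    {n : ℕ} (hn : n < N) : l (X ^ n) = 0 := by
  by_contra hln
  set φ : ℂ → ℂ := fun z => l (truncKernel N z) with hφ
  have hφ' : φ = fun z => ∑ n ∈ Finset.range N, z⁻¹ ^ (n + 1) * l (X ^ n) :=
    funext fun z => apply_truncKernel l N z
  have hφm : Measurable φ := by rw [hφ']; fun_prop
  have hφc : ContinuousOn φ {0}ᶜ := by
    rw [hφ']
    refine continuousOn_finsetSum _ fun k _ => ContinuousOn.mul (ContinuousOn.pow ?_ _)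
      continuousOn_const
    exact continuousOn_inv₀
  have hbound : ∀ z, z ≠ 0 → ‖z‖ ≤ 1 →
      ‖φ z‖ ≤ (∑ k ∈ Finset.range N, ‖l (X ^ k)‖) * ‖z‖⁻¹ ^ N := by
    intro z hz hz1
    rw [hφ', Finset.sum_mul]
    refine (norm_sum_le _ _).trans (Finset.sum_le_sum fun k hk => ?_)
    have hk := Finset.mem_range.1 hk
    rw [norm_mul, norm_pow, norm_inv, mul_comm]
    gcongr
    · exact (one_le_inv₀ (norm_pos_iff.2 hz)).2 hz1
    · omega
  have hder : derivative f ≠ 0 := fun h => by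
    have := derivative_eq_zero.1 h
    omega
  have hpush : ∀ A, MeasurableSet A →
      ∫⁻ z in A, ‖φ z‖ₑ ≤ ∫⁻ z in (fun z => f.eval z) ⁻¹' A, ‖φ z‖ₑ := by
    intro A hA
    refine setLIntegral_le_setLIntegral_preimage hder hφm.enorm (fun w hw hcrit => ?_) hA
    rw [hφ]
    simp only
    rw [hl w hw hcrit]
    refine (enorm_sum_le _ _).trans (Finset.sum_le_sum fun z hz => le_of_eq ?_)
    have hz' : f.eval z = w := by
      simpa [sub_eq_zero] using (mem_roots'.1 (Multiset.mem_toFinset.1 hz)).2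
    have hne := hcrit z hz'
    rw [enorm_mul, enorm_inv (pow_ne_zero 2 hne), mul_comm, ← norm_pow, ofReal_norm]
  obtain ⟨R, hR, hfR⟩ := exists_forall_norm_add_one_le hf hd
  have hgR : ∀ m z, R ≤ ‖z‖ → ‖z‖ + 1 ≤ ‖(f.comp^[m + 1] X).eval z‖ := by
    intro m
    induction m with
    | zero => intro z hz; simpa using hfR z hz
    | succ m ih =>
      intro z hz
      rw [Function.iterate_succ_apply', eval_comp]
      have := ih z hz
      linarith [hfR _ (show R ≤ ‖(f.comp^[m + 1] X).eval z‖ by linarith)]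
  have hgR' : ∀ z : ℂ, R ≤ ‖z‖ → ‖z‖ + 1 ≤ ‖(f.comp^[q] X).eval z‖ := by
    simpa [Nat.sub_add_cancel hq] using hgR (q - 1)
  have hzero := setLIntegral_eq_zero_of_le_preimage hN hg hR hgR' hφc hbound
    fun A hA => setLIntegral_le_setLIntegral_iterate_preimage hpush q hA
  set K := Metric.closedBall (0 : ℂ) (R + 1) \ Metric.closedBall 0 R with hK
  have hKm : MeasurableSet K := measurableSet_closedBall.diff measurableSet_closedBall
  rw [setLIntegral_eq_zero_iff hKm hφm.enorm] at hzero
  have hK0 : volume K = 0 := by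
    have hnull := (finite_setOf_apply_truncKernel_eq_zero hn hln).measure_zero volume
    rw [measure_eq_zero_iff_ae_notMem] at hnull ⊢
    filter_upwards [hzero, hnull] with z h1 h2 hz
    refine h2 ⟨?_, by simpa using h1 hz⟩
    rintro rfl
    exact hz.2 (Metric.mem_closedBall_self (by linarith))
  have hopen : Metric.ball (0 : ℂ) (R + 1) \ Metric.closedBall 0 R ⊆ K :=
    sdiff_subset_sdiff_left Metric.ball_subset_closedBall
  have hpos : 0 < volume (Metric.ball (0 : ℂ) (R + 1) \ Metric.closedBall 0 R) := by
    refine (Metric.isOpen_ball.sdiff Metric.isClosed_closedBall).measure_pos volume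
      ⟨((R + 1 / 2 : ℝ) : ℂ), ?_, ?_⟩
    · rw [mem_ball_zero_iff, Complex.norm_real, Real.norm_of_nonneg (by linarith)]
      linarith
    · rw [mem_closedBall_zero_iff, Complex.norm_real, Real.norm_of_nonneg (by linarith)]
      linarith
  exact (hpos.trans_le (measure_mono hopen)).ne' hK0

end Contraction

section Rigidity

variable {f D : ℂ[X]}

/-- The iterate of order `q` of a polynomial fixing `0` with multiplier a `q`-th root of unity can
be tangent to the identity to order `q + 1` only if some monomial vector field has an infinitesimal
effect of lower order on this iterate. -/
theorem exists_not_X_pow_dvd_sum_pullbackField (hf : X ∣ f) (hm : f.Monic) (hd : 2 ≤ f.natDegree)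
    {q : ℕ} (hq : 1 ≤ q) (hlam : f.coeff 1 ^ q = 1) (hD : X ^ (q + 2) ∣ D * derivative f - 1)
    (hg : X ^ (q + 2) ∣ f.comp^[q] X - X) :
    ∃ k, 2 ≤ k ∧ k < f.natDegree ∧
      ¬ X ^ (q + 2) ∣ ∑ j ∈ Finset.range q, (pullbackField f D)^[j] (X ^ k * D) := by
  by_contra! hS
  obtain ⟨l, hlN, hlA, hl1, hlS, v₀, hv₀, hlv₀⟩ := exists_invariant_functional hf hq hlam hD hg
  have hlX : ∀ k, k ≠ 0 → k < f.natDegree → l (X ^ k * D) = 0 := by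
    intro k hk hkd
    obtain rfl | hk' : k = 1 ∨ 2 ≤ k := by omega
    · simpa using hl1
    · exact hlS _ (hS k hk' hkd)
  let l' : ℂ[X] →ₗ[ℂ] ℂ := l - l 1 • lcoeff ℂ 0
  have hl' : ∀ v, l' v = l v - l 1 * v.coeff 0 := fun v => by simp [l']
  have hl'X : ∀ v, X ∣ v → l' v = l v := fun v hv => by rw [hl', X_dvd_iff.1 hv]; simp
  have hl'N : ∀ v, X ^ (q + 2) ∣ v → l' v = 0 := fun v hv => by
    rw [hl'X v ((dvd_pow_self X (by omega)).trans hv), hlN v hv]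
  have hl'C : ∀ c, l' (C c) = 0 := fun c => by
    rw [hl', ← mul_one (C c), ← smul_eq_C_mul, map_smul]
    simp [mul_comm]
  have hlam0 : f.coeff 1 ≠ 0 := by
    intro h
    rw [h, zero_pow (by omega)] at hlam
    exact zero_ne_one hlam
  have hl'k : ∀ k, k ≠ 0 → k < f.natDegree → l' (X ^ k * D) = 0 := fun k hk hkd => by
    rw [hl'X _ ((dvd_pow_self X hk).mul_right D), hlX k hk hkd]
  have hl'D : l' D = 0 := by
    have h1 : l' (derivative f * D) = 0 := by
      have := hl'N _ hD
      rwa [map_sub, ← C_1, hl'C, sub_zero, mul_comm] at this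
    rw [as_sum_range' (derivative f) f.natDegree (natDegree_derivative_lt (by omega)),
      Finset.sum_mul, map_sum, Finset.sum_eq_single 0] at h1
    · rw [monomial_zero_left, ← smul_eq_C_mul, map_smul, smul_eq_mul, coeff_derivative] at h1
      simpa [hlam0] using h1
    · intro k hk hk0
      rw [← C_mul_X_pow_eq_monomial, mul_assoc, ← smul_eq_C_mul, map_smul,
        hl'k k hk0 (Finset.mem_range.1 hk), smul_zero]
    · intro h
      simp only [Finset.mem_range] at h
      omega
  have hl'A : ∀ v, l' (pullbackField f D v) = l' v := by
    intro v
    obtain ⟨u, hu⟩ := X_dvd_sub_C (p := v)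
    have hXu : X ∣ X * u := dvd_mul_right X u
    rw [show v = C (v.coeff 0) + X * u by rw [← hu]; ring, map_add, map_add, map_add,
      hl'C, pullbackField_apply, C_comp, mul_comm, ← smul_eq_C_mul, map_smul, hl'D, smul_zero,
      hl'X _ hXu, ← hlA _ hXu, hl'X]
    rw [pullbackField_apply, mul_comp, X_comp]
    exact (hf.mul_right _).mul_left _
  have hl'D' : ∀ k, k + 1 < f.natDegree → l' (X ^ k * D) = 0 := by
    intro k hk
    obtain rfl | hk0 := eq_or_ne k 0
    · simpa using hl'D
    · exact hl'k k hk0 (by omega)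
  have hzero : ∀ n < q + 2, l' (X ^ n) = 0 := fun n hn =>
    apply_X_pow_eq_zero_of_pushforward_eq_self hf hd (by omega) hq hg
      (fun w hw hcrit => pushforward_eq_self hf hm hd hD hl'N hl'A hl'D' hw hcrit) hn
  have hall : ∀ v, l' v = 0 := by
    intro v
    rw [v.as_sum_range_C_mul_X_pow, map_sum]
    refine Finset.sum_eq_zero fun k _ => ?_
    rw [← smul_eq_C_mul, map_smul]
    obtain h | h := lt_or_ge k (q + 2)
    · rw [hzero k h, smul_zero]
    · rw [hl'N _ (pow_dvd_pow X h), smul_zero]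
  exact hlv₀ (by rw [← hl'X v₀ hv₀, hall])

theorem exists_X_pow_dvd_mul_derivative_sub_one (hlam : f.coeff 1 ≠ 0) (N : ℕ) :
    ∃ D : ℂ[X], X ^ N ∣ D * derivative f - 1 := by
  have h : IsCoprime (X ^ N) (derivative f) := by
    refine IsCoprime.pow_left (Irreducible.coprime_iff_not_dvd irreducible_X |>.2 ?_)
    rw [X_dvd_iff, coeff_derivative]
    simpa using hlam
  obtain ⟨a, b, hab⟩ := h
  exact ⟨b, -a, by rw [← hab]; ring⟩

end Rigidity

section Variation

/-- The first variation of `f^n` when `f` moves in the direction `v`. -/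
noncomputable def iterateVariation (f v : ℂ[X]) : ℕ → ℂ[X]
  | 0 => 0
  | n + 1 => (iterateVariation f v n).comp f + v * (derivative (f.comp^[n] X)).comp f

theorem comp_add_of_sq_eq_zero {R : Type*} [CommRing R] (p x y : R[X]) (hy : y ^ 2 = 0) :
    p.comp (x + y) = p.comp x + (derivative p).comp x * y := by
  have := eval_add_of_sq_eq_zero (p.map C) x y hy
  rwa [derivative_map, eval_map, eval_map, eval_map] at this

theorem iterate_comp_X_dualNumber (f v : ℂ[X]) (n : ℕ) :
    (f.map (algebraMap ℂ (DualNumber ℂ)) +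
        C DualNumber.eps * v.map (algebraMap ℂ (DualNumber ℂ))).comp^[n] X =
      (f.comp^[n] X).map (algebraMap ℂ (DualNumber ℂ)) +
        C DualNumber.eps * (iterateVariation f v n).map (algebraMap ℂ (DualNumber ℂ)) := by
  have hε : (C DualNumber.eps : (DualNumber ℂ)[X]) * C DualNumber.eps = 0 := by
    rw [← C_mul, DualNumber.eps_mul_eps, C_0]
  induction n with
  | zero => simp [iterateVariation]
  | succ n ih =>
    rw [iterate_comp_X_succ, ih, iterate_comp_X_succ f n, iterateVariation, add_comp, mul_comp,
      C_comp, comp_add_of_sq_eq_zero, comp_add_of_sq_eq_zero]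
    · simp only [Polynomial.map_add, Polynomial.map_mul, map_comp, derivative_map]
      linear_combination (((derivative (iterateVariation f v n)).map
        (algebraMap ℂ (DualNumber ℂ))).comp (f.map (algebraMap ℂ (DualNumber ℂ))) *
        v.map (algebraMap ℂ (DualNumber ℂ))) * hε
    all_goals rw [mul_pow, sq (C _), hε, zero_mul]

theorem X_pow_dvd_iterateVariation_sub {f D : ℂ[X]} (hf : X ∣ f) {N : ℕ}
    (hD : X ^ N ∣ D * derivative f - 1) (v : ℂ[X]) (n : ℕ) :
    X ^ N ∣ iterateVariation f v n - derivative (f.comp^[n] X) *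
      ∑ j ∈ Finset.range n, (pullbackField f D)^[j] (v * D) := by
  induction n with
  | zero => simp [iterateVariation]
  | succ n ih =>
    rw [Finset.sum_range_succ', iterateVariation, iterate_comp_X_succ, derivative_comp]
    simp only [Function.iterate_succ_apply', ← map_sum, Function.iterate_zero, id]
    set S := ∑ j ∈ Finset.range n, (pullbackField f D)^[j] (v * D)
    rw [pullbackField_apply]
    have h1 := X_pow_dvd_comp hf ih
    rw [sub_comp, mul_comp] at h1
    have h2 := hD.mul_right ((derivative (f.comp^[n] X)).comp f * (S.comp f + v))
    convert h1.sub h2 using 1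
    ring

end Variation

section SimpleRoots

theorem map_cubicFam (lam : ℂ) {S : Type*} [CommRing S] (φ : ℂ[X] →+* S) :
    (cubicFam lam).map φ = C (φ (C lam)) * X + C (φ X) * X ^ 2 + X ^ 3 := by
  simp [cubicFam]

theorem X_dvd_cubicFam (lam : ℂ) : X ∣ cubicFam lam :=
  ⟨C (C lam) + C X * X + X ^ 2, by rw [cubicFam]; ring⟩

theorem coeff_one_cubicFam (lam : ℂ) : (cubicFam lam).coeff 1 = C lam := by
  simp [cubicFam, coeff_X_pow]

theorem X_pow_dvd_iterate_cubicFam_sub_X {lam : ℂ} {q : ℕ} (hq : 1 ≤ q)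
    (hlam : IsPrimitiveRoot lam q) : X ^ (q + 1) ∣ (cubicFam lam).comp^[q] X - X := by
  refine X_pow_dvd_iterate_comp_sub_X (X_dvd_cubicFam lam) ?_ hq
  rw [coeff_one_cubicFam]
  exact hlam.map_of_injective C_injective

theorem coeff_iterate_cubicFam_simple_root {lam : ℂ} {q : ℕ} (hq : 1 ≤ q)
    (hlam : IsPrimitiveRoot lam q) {b : ℂ}
    (h0 : (((cubicFam lam).comp^[q] X).coeff (q + 1)).eval b = 0) :
    (derivative (((cubicFam lam).comp^[q] X).coeff (q + 1))).eval b ≠ 0 := by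
  intro h1
  set T := ((cubicFam lam).comp^[q] X).coeff (q + 1) with hT
  set φ : ℂ[X] →+* DualNumber ℂ :=
    (aeval (algebraMap ℂ (DualNumber ℂ) b + DualNumber.eps)).toRingHom with hφ
  have hφT : φ T = 0 := by
    have := aeval_add_of_sq_eq_zero T (algebraMap ℂ (DualNumber ℂ) b) DualNumber.eps
      (by rw [sq, DualNumber.eps_mul_eps])
    rw [aeval_algebraMap_apply, aeval_algebraMap_apply, coe_aeval_eq_eval, h0, h1] at this
    simpa [hφ] using this
  set f : ℂ[X] := C lam * X + C b * X ^ 2 + X ^ 3 with hf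
  have hmap : (cubicFam lam).map φ = f.map (algebraMap ℂ (DualNumber ℂ)) +
      C DualNumber.eps * (X ^ 2 : ℂ[X]).map (algebraMap ℂ (DualNumber ℂ)) := by
    rw [map_cubicFam, hf]
    simp only [hφ, AlgHom.toRingHom_eq_coe, RingHom.coe_coe, aeval_C, aeval_X,
      Polynomial.map_add, Polynomial.map_mul,
      Polynomial.map_pow, map_X, map_C, C_add]
    ring
  have hcoeff : ∀ k < q + 2, φ (((cubicFam lam).comp^[q] X - X).coeff k) = 0 := by
    intro k hk
    obtain h | rfl : k < q + 1 ∨ k = q + 1 := by omega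
    · rw [X_pow_dvd_iff.1 (X_pow_dvd_iterate_cubicFam_sub_X hq hlam) k h, map_zero]
    · rw [coeff_sub, ← hT, map_sub, hφT, coeff_X, if_neg (by omega), map_zero, sub_zero]
  have hsplit : ∀ k < q + 2, (f.comp^[q] X - X).coeff k = 0 ∧
      (iterateVariation f (X ^ 2) q).coeff k = 0 := by
    intro k hk
    have := hcoeff k hk
    rw [← coeff_map, Polynomial.map_sub, map_iterate_comp, hmap, iterate_comp_X_dualNumber, map_X,
      add_sub_right_comm, ← map_X (algebraMap ℂ (DualNumber ℂ)), ← Polynomial.map_sub, coeff_add,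
      coeff_map, coeff_C_mul, coeff_map] at this
    have h1 := congr_arg TrivSqZeroExt.fst this
    have h2 := congr_arg TrivSqZeroExt.snd this
    simp [TrivSqZeroExt.algebraMap_eq_inl] at h1 h2
    exact ⟨by simpa using h1, h2⟩
  have hg : X ^ (q + 2) ∣ f.comp^[q] X - X := X_pow_dvd_iff.2 fun k hk => (hsplit k hk).1
  have he : X ^ (q + 2) ∣ iterateVariation f (X ^ 2) q :=
    X_pow_dvd_iff.2 fun k hk => (hsplit k hk).2
  have hdeg : f.natDegree = 3 := by rw [hf]; compute_degree!
  have hm : f.Monic := by rw [hf]; monicity!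
  have hXf : X ∣ f := ⟨C lam + C b * X + X ^ 2, by rw [hf]; ring⟩
  have hf1 : f.coeff 1 = lam := by simp [hf, coeff_X_pow]
  obtain ⟨D, hD⟩ := exists_X_pow_dvd_mul_derivative_sub_one (f := f)
    (by rw [hf1]; exact hlam.ne_zero (by omega)) (q + 2)
  obtain ⟨k, hk2, hk3, hk⟩ := exists_not_X_pow_dvd_sum_pullbackField hXf hm (by omega) hq
    (by rw [hf1]; exact hlam.pow_eq_one) hD hg
  obtain rfl : k = 2 := by omega
  refine hk ?_
  have h3 := (dvd_sub_right he).1 (X_pow_dvd_iterateVariation_sub hXf hD (X ^ 2) q)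
  refine IsCoprime.dvd_of_dvd_mul_left ?_ h3
  refine IsCoprime.pow_left (Irreducible.coprime_iff_not_dvd irreducible_X |>.2 ?_)
  rw [X_dvd_iff, coeff_derivative, coeff_one_iterate_comp hXf, hf1, hlam.pow_eq_one]
  simp

end SimpleRoots

section Degree

theorem C_mul_iterate_comp_X {R : Type*} [CommRing R] {f h : R[X]} {b : R}
    (hfh : C b * f = h.comp (C b * X)) (n : ℕ) :
    C b * f.comp^[n] X = (h.comp^[n] X).comp (C b * X) := by
  induction n with
  | zero => simp
  | succ n ih =>
    rw [Function.iterate_succ_apply', Function.iterate_succ_apply', comp_assoc, ← ih,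
      show C b * f.comp (f.comp^[n] X) = (C b * f).comp (f.comp^[n] X) by simp, hfh, comp_assoc]
    simp

/-- If `b T(b) = b ^ (q + 1) R(1 / b ^ 2)` for all `b ≠ 0`, where `R(0) ≠ 0`, then `T` has
degree `q`. -/
theorem natDegree_eq_of_eval_inv_sq {T R : ℂ[X]} {q : ℕ} (hR : R.coeff 0 ≠ 0)
    (h : ∀ b : ℂ, b ≠ 0 → b * T.eval b = b ^ (q + 1) * R.eval (b ^ 2)⁻¹) :
    T ≠ 0 ∧ T.natDegree = q := by
  have hR0 : R ≠ 0 := by rintro rfl; simp at hR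
  have key : X ^ (2 * R.natDegree + 1) * T = X ^ (q + 1) * expand ℂ 2 R.reverse := by
    refine Polynomial.funext fun b => ?_
    simp only [eval_mul, eval_pow, eval_X, expand_eval]
    obtain rfl | hb := eq_or_ne b 0
    · simp
    have hb2 : (b ^ 2)⁻¹ ≠ 0 := inv_ne_zero (pow_ne_zero 2 hb)
    let _ := invertibleOfNonzero hb2
    have h1 := eval₂_reverse_mul_pow (RingHom.id ℂ) (b ^ 2)⁻¹ R
    rw [eval₂_id, eval₂_id, invOf_eq_inv, inv_inv] at h1
    rw [pow_succ b (2 * _), mul_assoc, h b hb, ← h1, pow_mul, inv_pow]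
    field_simp
  have hrev : R.reverse ≠ 0 := reverse_eq_zero.not.2 hR0
  have hexp : expand ℂ 2 R.reverse ≠ 0 := (expand_ne_zero (by norm_num)).2 hrev
  have hT : T ≠ 0 := by
    rintro rfl
    rw [mul_zero] at key
    exact mul_ne_zero (pow_ne_zero _ X_ne_zero) hexp key.symm
  have hdeg := congr_arg natDegree key
  rw [natDegree_mul (pow_ne_zero _ X_ne_zero) hT, natDegree_mul (pow_ne_zero _ X_ne_zero) hexp,
    natDegree_X_pow, natDegree_X_pow, natDegree_expand, reverse_natDegree,
    natTrailingDegree_eq_zero.2 (.inr hR)] at hdeg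
  exact ⟨hT, by omega⟩

theorem coeff_iterate_quadratic_ne_zero {lam : ℂ} {q : ℕ} (hq : 1 ≤ q)
    (hlam : IsPrimitiveRoot lam q) : ((C lam * X + X ^ 2 : ℂ[X]).comp^[q] X).coeff (q + 1) ≠ 0 := by
  intro h0
  set f : ℂ[X] := C lam * X + X ^ 2 with hf
  have hdeg : f.natDegree = 2 := by rw [hf]; compute_degree!
  have hm : f.Monic := by rw [hf]; monicity!
  have hXf : X ∣ f := ⟨C lam + X, by rw [hf]; ring⟩
  have hf1 : f.coeff 1 = lam := by simp [hf, coeff_X_pow]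
  have hg : X ^ (q + 2) ∣ f.comp^[q] X - X := by
    refine X_pow_dvd_iff.2 fun k hk => ?_
    obtain h | rfl : k < q + 1 ∨ k = q + 1 := by omega
    · exact X_pow_dvd_iff.1 (X_pow_dvd_iterate_comp_sub_X hXf (by rwa [hf1]) hq) k h
    · rw [coeff_sub, h0, coeff_X, if_neg (by omega), sub_zero]
  obtain ⟨D, hD⟩ := exists_X_pow_dvd_mul_derivative_sub_one (f := f)
    (by rw [hf1]; exact hlam.ne_zero (by omega)) (q + 2)
  obtain ⟨k, hk2, hk3, -⟩ := exists_not_X_pow_dvd_sum_pullbackField hXf hm (by omega) hq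
    (by rw [hf1]; exact hlam.pow_eq_one) hD hg
  omega

theorem coeff_iterate_cubicFam_natDegree {lam : ℂ} {q : ℕ} (hq : 1 ≤ q)
    (hlam : IsPrimitiveRoot lam q) :
    ((cubicFam lam).comp^[q] X).coeff (q + 1) ≠ 0 ∧
      (((cubicFam lam).comp^[q] X).coeff (q + 1)).natDegree = q := by
  set h : ℂ[X][X] := C (C lam) * X + X ^ 2 + C X * X ^ 3 with hh
  have hmap : ∀ ε, h.map (evalRingHom ε) = C lam * X + X ^ 2 + C ε * X ^ 3 := fun ε => by
    simp [hh]
  refine natDegree_eq_of_eval_inv_sq (R := (h.comp^[q] X).coeff (q + 1)) ?_ fun b hb => ?_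
  · rw [coeff_zero_eq_eval_zero, ← coe_evalRingHom, ← coeff_map, map_iterate_comp, hmap]
    simpa using coeff_iterate_quadratic_ne_zero hq hlam
  · rw [← coe_evalRingHom, ← coe_evalRingHom, ← coeff_map, ← coeff_map, map_iterate_comp,
      map_iterate_comp, hmap, map_cubicFam, ← coeff_C_mul,
      C_mul_iterate_comp_X (h := C lam * X + X ^ 2 + C (b ^ 2)⁻¹ * X ^ 3),
      comp_C_mul_X_coeff, mul_comm]
    have hb' : (C (b ^ 2)⁻¹ : ℂ[X]) * C b ^ 2 = 1 := by
      rw [← C_pow, ← C_mul, inv_mul_cancel₀ (pow_ne_zero 2 hb), C_1]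
    simp only [coe_evalRingHom, eval_C, eval_X, add_comp, mul_comp, C_comp, X_comp, X_pow_comp]
    linear_combination -(C b * X ^ 3) * hb'

end Degree

/-- for `λ = e^{2πip/q}` with `p, q` coprime, the polynomial
`T_{p/q}(b)` (the coefficient of `z^{q+1}` in `f_{λ,b}^{∘q}`) has degree exactly `q`
and has `q` distinct complex roots (all of its roots are simple). -/
theorem T_pq_degree_and_simple_roots (p : ℤ) (q : ℕ) (hq : 1 ≤ q)
    (hcop : Int.gcd p (q : ℤ) = 1)
    (lam : ℂ) (hlam : lam = Complex.exp (2 * Real.pi * Complex.I * (p : ℂ) / (q : ℂ)))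
    (T : Polynomial ℂ)
    (hT : T = ((fun s => (cubicFam lam).comp s)^[q] Polynomial.X).coeff (q + 1)) :
    T.natDegree = q ∧ T.roots.Nodup ∧ Multiset.card T.roots = q := by
  have hprim : IsPrimitiveRoot lam q := by
    have := (Complex.isPrimitiveRoot_exp q (by omega)).zpow_of_gcd_eq_one p hcop
    rwa [← Complex.exp_int_mul, ← mul_div_assoc, mul_comm, ← hlam] at this
  change T = ((cubicFam lam).comp^[q] X).coeff (q + 1) at hT
  obtain ⟨hT0, hdeg⟩ := coeff_iterate_cubicFam_natDegree hq hprim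
  rw [← hT] at hT0 hdeg
  refine ⟨hdeg, ?_, ?_⟩
  · refine Multiset.nodup_iff_count_le_one.2 fun b => ?_
    rw [count_roots]
    by_contra! hb
    obtain ⟨h0, h1⟩ := (one_lt_rootMultiplicity_iff_isRoot hT0).1 hb
    rw [hT] at h0 h1
    exact coeff_iterate_cubicFam_simple_root hq hprim h0 h1
  · rw [← hdeg]
    exact (splits_iff_card_roots).1 (IsAlgClosed.splits T)
end

section
/- Let q ≥ 1 be an integer and a ∈ ℂ, and let g be a function holomorphic on a neighborhood of 0 ∈ ℂ such that g(z) = z + a·z^{q+1} + O(z^{q+2}) as z → 0 (i.e., g is analytic at 0 and its Taylor expansion at 0 is z + a·z^{q+1} plus terms of order at least q+2). Then the function z ↦ (g(z))^{−q} − z^{−q}, which is defined for all sufficiently small nonzero z, tends to −q·a as z → 0 through nonzero values. -/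
/-- if `g` is analytic at `0` with `g(z) = z + a z^{q+1} + O(z^{q+2})`,
then `(g z)^{-q} - z^{-q} → -q·a` as `z → 0` through nonzero values. -/
theorem inverse_power_coordinate_limit (q : ℕ) (hq : 1 ≤ q) (a : ℂ) (g : ℂ → ℂ)
    (hg : AnalyticAt ℂ g 0)
    (hexp : (fun z : ℂ => g z - (z + a * z ^ (q + 1))) =O[nhds 0]
      fun z : ℂ => z ^ (q + 2)) :
    Filter.Tendsto (fun z : ℂ => (g z) ^ (-(q : ℤ)) - z ^ (-(q : ℤ)))
      (nhdsWithin 0 {(0 : ℂ)}ᶜ) (nhds (-(q : ℂ) * a)) := by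
  have hne : ∀ᶠ z : ℂ in nhdsWithin 0 {(0 : ℂ)}ᶜ, z ≠ 0 := self_mem_nhdsWithin
  have hv : Filter.Tendsto (fun z : ℂ => (g z - z) / z ^ (q + 1))
      (nhdsWithin 0 {(0 : ℂ)}ᶜ) (nhds a) := by
    have hpow : (fun z : ℂ => z ^ (q + 2)) =o[nhds 0] fun z : ℂ => z ^ (q + 1) :=
      Asymptotics.isLittleO_pow_pow (by omega)
    have h := (((hexp.trans_isLittleO hpow).tendsto_div_nhds_zero).mono_left
      (nhdsWithin_le_nhds (s := {(0 : ℂ)}ᶜ))).add_const a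
    rw [zero_add] at h
    refine h.congr' ?_
    filter_upwards [hne] with z hz
    field_simp
    ring
  have hzq : Filter.Tendsto (fun z : ℂ => z ^ q) (nhdsWithin 0 {(0 : ℂ)}ᶜ) (nhds 0) := by
    have h : Filter.Tendsto (fun z : ℂ => z ^ q) (nhds 0) (nhds (0 ^ q)) :=
      (continuous_pow q).tendsto 0
    rw [zero_pow (by omega)] at h
    exact h.mono_left nhdsWithin_le_nhds
  have hu : Filter.Tendsto (fun z : ℂ => g z / z) (nhdsWithin 0 {(0 : ℂ)}ᶜ) (nhds 1) := by
    have h := (hzq.mul hv).const_add 1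
    rw [zero_mul, add_zero] at h
    refine h.congr' ?_
    filter_upwards [hne] with z hz
    field_simp
    ring
  have hsum : Filter.Tendsto (fun z : ℂ => ∑ i ∈ Finset.range q, (g z / z) ^ i)
      (nhdsWithin 0 {(0 : ℂ)}ᶜ) (nhds q) := by
    simpa using tendsto_finsetSum (Finset.range q) fun i _ => hu.pow i
  have hlim := (hv.neg.mul hsum).div (hu.pow q) (by simp)
  rw [one_pow, div_one, neg_mul, mul_comm a, ← neg_mul] at hlim
  refine hlim.congr' ?_
  filter_upwards [hne, hu.eventually_ne one_ne_zero] with z hz hgz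
  have hg0 : g z ≠ 0 := fun h => hgz (by simp [h])
  have hgeom := geom_sum_mul (g z / z) q
  have hfac : (g z - z) / z ^ (q + 1) = (g z / z - 1) / z ^ q := by
    field_simp
    ring
  simp only [Pi.div_apply]
  rw [hfac, neg_mul, div_mul_eq_mul_div, mul_comm, hgeom, zpow_neg, zpow_neg,
    zpow_natCast, zpow_natCast, div_pow]
  field_simp
  ring
end
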